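/- arXiv:0905.2576 — 2 statements merged into one kernel-verified Lean document; each statement's English description precedes it below -/
import Mathlib

section
/- Let X be a continuum without cut points such that for every pair of distinct points c, d ∈ X there is a cut pair {a,b} separating c from d. Then X is homeomorphic to the circle S¹. -/
open Set

section Defs

variable {X : Type*} [TopologicalSpace X]

/-- `U` is relatively open in the subspace `X - C`. -/
def RelOpen (C U : Set X) : Prop := ∃ O : Set X, IsOpen O ∧ U = O ∩ Cᶜ

/-- `U, V` form a disconnection of `X - C` into two nonempty relatively open sets. -/
def SepPair (C U V : Set X) : Prop :=
  RelOpen C U ∧ RelOpen C V ∧ Disjoint U V ∧ U ∪ V = Cᶜ ∧ U.Nonempty ∧ V.Nonempty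

/-- `C` separates `A` from `B`. -/
def Separates (C A B : Set X) : Prop := ∃ U V : Set X, SepPair C U V ∧ A ⊆ U ∧ B ⊆ V

/-- `C` separates `X`, i.e. `X - C` is disconnected. -/
def Cuts (C : Set X) : Prop := ∃ U V : Set X, SepPair C U V

def CutPoint (c : X) : Prop := Cuts ({c} : Set X)

def CutPair (c d : X) : Prop := c ≠ d ∧ ¬CutPoint c ∧ ¬CutPoint d ∧ Cuts ({c, d} : Set X)

def IsSubcontinuum (Y : Set X) : Prop := IsCompact Y ∧ IsConnected Y

/-- A nondegenerate set no two of whose points are separated by a cut pair. -/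
def InsepSet (A : Set X) : Prop :=
  A.Nontrivial ∧ ∀ c d : X, CutPair c d → ∀ a ∈ A, ∀ b ∈ A,
    ¬Separates ({c, d} : Set X) {a} {b}

def MaxInsep (A : Set X) : Prop := InsepSet A ∧ ∀ B : Set X, InsepSet B → A ⊆ B → B = A

def InsepCutPair (a b : X) : Prop := CutPair a b ∧ InsepSet ({a, b} : Set X)

/-- A cyclic decomposition of `X` by the points `x 0, …, x (n-1)` (cyclically indexed),
into subcontinua `M i`, consecutive ones meeting in a single point. -/
def CyclicDecomp (n : ℕ) (x : ZMod n → X) (M : ZMod n → Set X) : Prop :=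
  2 < n ∧ Function.Injective x ∧
  (∀ i, IsSubcontinuum (M i)) ∧
  (∀ i, M i ∩ M (i + 1) = {x (i + 1)}) ∧
  (∀ i j, i ≠ j → j ≠ i + 1 → i ≠ j + 1 → M i ∩ M j = ∅) ∧
  (⋃ i, M i) = univ

/-- A finite set is cyclic if it is a cut pair, or admits a cyclic decomposition. -/
def CyclicFinset (S : Set X) : Prop :=
  (∃ a b : X, CutPair a b ∧ S = {a, b}) ∨
  (∃ n : ℕ, ∃ (x : ZMod n → X) (M : ZMod n → Set X), CyclicDecomp n x M ∧ S = Set.range x)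

/-- A set (with more than one point) is cyclic if every finite subset with more
than one element is cyclic. -/
def CyclicSet (S : Set X) : Prop :=
  ∀ A : Finset X, ↑A ⊆ S → 1 < A.card → CyclicFinset (↑A : Set X)

/-- A necklace: a maximal cyclic subset with more than two elements. -/
def Necklace (S : Set X) : Prop :=
  CyclicSet S ∧ (∃ a ∈ S, ∃ b ∈ S, ∃ c ∈ S, a ≠ b ∧ a ≠ c ∧ b ≠ c) ∧
  ∀ S' : Set X, CyclicSet S' → S ⊆ S' → S' = S

/-- Membership in the collection `R`: necklaces, maximal inseparable sets,
and inseparable cut pairs. -/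
def InR (S : Set X) : Prop :=
  Necklace S ∨ MaxInsep S ∨ ∃ a b : X, InsepCutPair a b ∧ S = {a, b}

/-- `A` has exactly two connected components. -/
def TwoComponents (A : Set X) : Prop :=
  ∃ u ∈ A, ∃ v ∈ A, connectedComponentIn A u ≠ connectedComponentIn A v ∧
    ∀ w ∈ A, connectedComponentIn A w = connectedComponentIn A u ∨
      connectedComponentIn A w = connectedComponentIn A v

/-- `S`-equivalence of points of `X - S`: they lie in the same piece of every
cyclic decomposition of `X` by a finite subset of `S`. -/
def SEquiv (S : Set X) (y z : X) : Prop :=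
  y ∉ S ∧ z ∉ S ∧
  ∀ (n : ℕ) (x : ZMod n → X) (M : ZMod n → Set X),
    CyclicDecomp n x M → Set.range x ⊆ S → ∃ i, y ∈ M i ∧ z ∈ M i

end Defs

section Splitting

variable {X : Type*} [TopologicalSpace X]

theorem IsPreconnected.left_of_inter_eq_singleton {A E F : Set X} {p : X} (hA : IsPreconnected A)
    (hE : IsClosed E) (hF : IsClosed F) (hun : E ∪ F = A) (hin : E ∩ F = {p}) :
    IsPreconnected E := by
  have key : ∀ t t' : Set X, IsClosed t → IsClosed t' → E ⊆ t ∪ t' → p ∈ t →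
      (E ∩ t').Nonempty → (E ∩ (t ∩ t')).Nonempty := by
    intro t t' ht ht' hs hp ⟨y, hyE, hyt⟩
    have hpE : p ∈ E := (hin.ge rfl).1
    have hpF : p ∈ F := (hin.ge rfl).2
    obtain ⟨z, hzA, hz, hz'⟩ := isPreconnected_closed_iff.1 hA ((E ∩ t) ∪ F) (E ∩ t')
      ((hE.inter ht).union hF) (hE.inter ht')
      (by
        intro z hz
        rw [← hun] at hz
        rcases hz with hz | hz
        · rcases hs hz with h | h
          · exact Or.inl (Or.inl ⟨hz, h⟩)
          · exact Or.inr ⟨hz, h⟩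
        · exact Or.inl (Or.inr hz))
      ⟨p, hun ▸ Or.inl hpE, Or.inr hpF⟩ ⟨y, hun ▸ Or.inl hyE, hyE, hyt⟩
    rcases hz with hz | hz
    · exact ⟨z, hz.1, hz.2, hz'.2⟩
    · have : z = p := hin.le ⟨hz'.1, hz⟩
      exact ⟨z, hz'.1, this ▸ hp, hz'.2⟩
  rw [isPreconnected_closed_iff]
  intro t t' ht ht' hs h h'
  have hpE : p ∈ E := (hin.ge rfl).1
  rcases hs hpE with hp | hp
  · exact key t t' ht ht' hs hp h'
  · rw [inter_comm t t']
    exact key t' t ht' ht (by rwa [union_comm]) hp h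

/-- The closed sets `E ∋ a` and `F ∋ b` cover `A` and meet exactly in the point `c`. -/
structure SplitsAt (A : Set X) (a b c : X) (E F : Set X) : Prop where
  closed_left : IsClosed E
  closed_right : IsClosed F
  union_eq : E ∪ F = A
  inter_eq : E ∩ F = {c}
  mem_left : a ∈ E
  mem_right : b ∈ F

namespace SplitsAt

variable {A E F E' F' : Set X} {a b c d x : X}

theorem symm (h : SplitsAt A a b c E F) : SplitsAt A b a c F E :=
  ⟨h.closed_right, h.closed_left, by rw [union_comm, h.union_eq],
    by rw [inter_comm, h.inter_eq], h.mem_right, h.mem_left⟩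

theorem eq_of_mem (h : SplitsAt A a b c E F) (hE : x ∈ E) (hF : x ∈ F) : x = c :=
  h.inter_eq.le ⟨hE, hF⟩

theorem mem_left_self (h : SplitsAt A a b c E F) : c ∈ E := (h.inter_eq.ge rfl).1

theorem mem_right_self (h : SplitsAt A a b c E F) : c ∈ F := (h.inter_eq.ge rfl).2

theorem left_subset (h : SplitsAt A a b c E F) : E ⊆ A := h.union_eq ▸ subset_union_left

theorem right_subset (h : SplitsAt A a b c E F) : F ⊆ A := h.union_eq ▸ subset_union_right

theorem mem_or (h : SplitsAt A a b c E F) (hx : x ∈ A) : x ∈ E ∨ x ∈ F := h.union_eq.ge hx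

theorem isPreconnected_left (h : SplitsAt A a b c E F) (hA : IsPreconnected A) :
    IsPreconnected E :=
  hA.left_of_inter_eq_singleton h.closed_left h.closed_right h.union_eq h.inter_eq

theorem isPreconnected_right (h : SplitsAt A a b c E F) (hA : IsPreconnected A) :
    IsPreconnected F :=
  h.symm.isPreconnected_left hA

theorem left_subset_left (h : SplitsAt A a b c E F) (h' : SplitsAt A a b d E' F')
    (hA : IsPreconnected A) (hd : d ∉ E) : E ⊆ E' := by
  have hempty : E ∩ (E' ∩ F') = ∅ := by
    rw [h'.inter_eq]
    simpa using hd
  rcases isPreconnected_iff_subset_of_disjoint_closed.1 (h.isPreconnected_left hA) E' F'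
    h'.closed_left h'.closed_right (h'.union_eq ▸ h.left_subset) hempty with hs | hs
  · exact hs
  · exact absurd (h'.eq_of_mem h'.mem_left (hs h.mem_left)) (fun e => hd (e ▸ h.mem_left))

theorem right_subset_right (h : SplitsAt A a b c E F) (h' : SplitsAt A a b d E' F')
    (hA : IsPreconnected A) (hd : d ∉ F) : F ⊆ F' :=
  h.symm.left_subset_left h'.symm hA hd

theorem nested (h : SplitsAt A a b c E F) (h' : SplitsAt A a b d E' F')
    (hA : IsPreconnected A) (hd : d ∉ E) : E ⊆ E' ∧ F' ⊆ F ∧ c ∉ F' := by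
  have hs := h.left_subset_left h' hA hd
  have hcF' : c ∉ F' := fun hc =>
    hd (h'.eq_of_mem (hs h.mem_left_self) hc ▸ h.mem_left_self)
  exact ⟨hs, h'.right_subset_right h hA hcF', hcF'⟩

theorem trichotomy (h : SplitsAt A a b c E F) (h' : SplitsAt A a b d E' F')
    (hA : IsPreconnected A) : c = d ∨ d ∉ E ∨ c ∉ E' := by
  by_contra! hcon
  obtain ⟨hne, hd, hc⟩ := hcon
  have hdF : d ∉ F := fun hdF => hne (h.eq_of_mem hd hdF).symm
  exact hdF (h.right_subset_right h' hA hdF |> fun hs =>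
    absurd (h'.eq_of_mem hc (hs h.mem_right_self)) hne)

/-- Two splittings with `x` on the right have a common upper bound with `x` on the right. -/
theorem exists_upper (h : SplitsAt A a b c E F) (h' : SplitsAt A a b d E' F')
    (hA : IsPreconnected A) (hx : x ∈ F) (hx' : x ∈ F') :
    ∃ e G H, SplitsAt A a b e G H ∧ x ∈ H ∧ E ⊆ G ∧ E' ⊆ G ∧ H ⊆ F ∧ H ⊆ F' := by
  rcases h.trichotomy h' hA with rfl | hd | hc
  · refine ⟨c, E ∪ E', F ∩ F', ⟨h.closed_left.union h'.closed_left,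
      h.closed_right.inter h'.closed_right, ?_, ?_, Or.inl h.mem_left,
      ⟨h.mem_right, h'.mem_right⟩⟩, ⟨hx, hx'⟩, subset_union_left, subset_union_right,
      inter_subset_left, inter_subset_right⟩
    · ext z
      have := h.union_eq
      have := h'.union_eq
      grind
    · ext z
      have := h.inter_eq
      have := h'.inter_eq
      grind
  · obtain ⟨h1, h2, -⟩ := h.nested h' hA hd
    exact ⟨d, E', F', h', hx', h1, Subset.rfl, h2, Subset.rfl⟩
  · obtain ⟨h1, h2, -⟩ := h'.nested h hA hc
    exact ⟨c, E, F, h, hx, Subset.rfl, h1, Subset.rfl, h2⟩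

theorem isPreconnected_inter (h : SplitsAt A a b c E F) (h' : SplitsAt A a b d E' F')
    (hA : IsPreconnected A) (hFF : F' ⊆ F) : IsPreconnected (F ∩ E') := by
  refine (h.isPreconnected_right hA).left_of_inter_eq_singleton (p := d) (F := F')
    (h.closed_right.inter h'.closed_left) h'.closed_right ?_ ?_
  · ext z
    have h1 : z ∈ F → z ∈ E' ∨ z ∈ F' := fun hz => h'.mem_or (h.right_subset hz)
    grind
  · ext z
    have h1 : z ∈ E' → z ∈ F' → z = d := h'.eq_of_mem
    have h2 := h'.mem_left_self
    have h3 := h'.mem_right_self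
    grind

end SplitsAt

/-- Any two points lie in different parts of a covering by two closed sets that
meet in at most two points. -/
def PairSeparated (X : Type*) [TopologicalSpace X] : Prop :=
  ∀ u v : X, u ≠ v → ∃ (p q : X) (P Q : Set X), IsClosed P ∧ IsClosed Q ∧ P ∪ Q = univ ∧
    P ∩ Q = {p, q} ∧ u ∉ Q ∧ v ∉ P

/-- A closed covering of `X` by two sets that meet in at most one point is trivial up to
that point. -/
def NoClosedCut (X : Type*) [TopologicalSpace X] : Prop :=
  ∀ (p : X) (E F : Set X), IsClosed E → IsClosed F → E ∪ F = univ → E ∩ F ⊆ {p} →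
    E ⊆ {p} ∨ F ⊆ {p}

/-- `X` is the union of two closed connected sets that meet exactly in `a` and `b`. -/
structure CircularCover (a b : X) (A B : Set X) : Prop where
  ne : a ≠ b
  closed_left : IsClosed A
  closed_right : IsClosed B
  preconnected_left : IsPreconnected A
  preconnected_right : IsPreconnected B
  union_eq : A ∪ B = univ
  inter_eq : A ∩ B = {a, b}

theorem isPreconnected_of_noClosedCut (hX : NoClosedCut X) {a b : X} {A B : Set X}
    (hA : IsClosed A) (hB : IsClosed B) (hun : A ∪ B = univ)
    (hin : A ∩ B = {a, b}) (hA' : ¬A ⊆ {a, b}) (hB' : ¬B ⊆ {a, b}) : IsPreconnected A := by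
  rw [isPreconnected_iff_subset_of_disjoint_closed]
  intro t t' ht ht' hs hd
  have haA : a ∈ A := (hin.ge (by simp)).1
  have hbA : b ∈ A := (hin.ge (by simp)).1
  have hin' : ∀ z, z ∈ A → z ∈ B → z = a ∨ z = b := fun z hz hz' => hin.le ⟨hz, hz'⟩
  have hun' : ∀ z, z ∈ A ∨ z ∈ B := fun z => hun.ge (mem_univ z)
  obtain ⟨w, hwA, hw⟩ := not_subset.1 hA'
  obtain ⟨v, hvB, hv⟩ := not_subset.1 hB'
  simp only [mem_insert_iff, mem_singleton_iff, not_or] at hw hv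
  have key : ∀ t t' : Set X, IsClosed t → IsClosed t' → A ⊆ t ∪ t' → A ∩ (t ∩ t') = ∅ →
      a ∈ t → A ⊆ t := by
    intro t t' ht ht' hs hd hat
    have hs' : ∀ z ∈ A, z ∈ t ∨ z ∈ t' := hs
    have hd' : ∀ z ∈ A, z ∈ t → z ∉ t' := fun z hz h h' => hd.le ⟨hz, h, h'⟩
    by_cases hbt : b ∈ t
    · rcases hX a (A ∩ t') ((A ∩ t) ∪ B) (hA.inter ht') ((hA.inter ht).union hB)
        (by ext z; grind) (by intro z; grind) with h | h
      · intro z hz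
        have := @h z
        grind
      · exact absurd (h (Or.inr hvB)) hv.1
    · rcases hX a (A ∩ t) ((A ∩ t') ∪ B) (hA.inter ht) ((hA.inter ht').union hB)
        (by ext z; grind) (by intro z; grind) with h1 | h1
      · rcases hX b (A ∩ t') ((A ∩ t) ∪ B) (hA.inter ht') ((hA.inter ht).union hB)
          (by ext z; grind) (by intro z; grind) with h2 | h2
        · rcases hs' w hwA with hw' | hw'
          · exact absurd (h1 ⟨hwA, hw'⟩) hw.1
          · exact absurd (h2 ⟨hwA, hw'⟩) hw.2
        · exact absurd (h2 (Or.inr hvB)) hv.2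
      · exact absurd (h1 (Or.inr hvB)) hv.1
  rcases hs haA with h | h
  · exact Or.inl (key t t' ht ht' hs hd h)
  · exact Or.inr (key t' t ht' ht (by rwa [union_comm]) (by rwa [inter_comm t' t]) h)

namespace CircularCover

variable {a b c d x : X} {A B E F E' F' : Set X}

theorem swap (h : CircularCover a b A B) : CircularCover b a A B :=
  ⟨h.ne.symm, h.closed_left, h.closed_right, h.preconnected_left, h.preconnected_right,
    h.union_eq, by rw [h.inter_eq, pair_comm]⟩

theorem symm (h : CircularCover a b A B) : CircularCover a b B A :=
  ⟨h.ne, h.closed_right, h.closed_left, h.preconnected_right, h.preconnected_left,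
    by rw [union_comm, h.union_eq], by rw [inter_comm, h.inter_eq]⟩

theorem mem_left (h : CircularCover a b A B) : a ∈ A := (h.inter_eq.ge (by simp)).1

theorem mem_right (h : CircularCover a b A B) : b ∈ A := (h.inter_eq.ge (by simp)).1

/-- Strictly between two splitting points there is another one. -/
theorem exists_between (h : CircularCover a b A B) (hsep : PairSeparated X)
    (hc : SplitsAt A a b c E F) (hd : SplitsAt A a b d E' F') (hdE : d ∉ E) :
    ∃ p G H, SplitsAt A a b p G H ∧ p ∈ F ∧ p ∈ E' ∧ p ≠ c ∧ p ≠ d := by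
  obtain ⟨hEE, hFF, hcF⟩ := hc.nested hd h.preconnected_left hdE
  have hcd : c ≠ d := fun e => hdE (e ▸ hc.mem_left_self)
  obtain ⟨p, q, P, Q, hP, hQ, hPQ, hPQ', hcQ, hdP⟩ := hsep c d hcd
  have hcP : c ∈ P := (hPQ.ge (mem_univ c)).resolve_right hcQ
  have hdQ : d ∈ Q := (hPQ.ge (mem_univ d)).resolve_left hdP
  have hcE := hc.mem_left_self
  have hcF' := hc.mem_right_self
  have hdE' := hd.mem_left_self
  have hdF' := hd.mem_right_self
  have haB : a ∈ B := h.symm.mem_left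
  have hbB : b ∈ B := h.symm.mem_right
  have hM : IsPreconnected (F ∩ E') := hc.isPreconnected_inter hd h.preconnected_left hFF
  have hN : IsPreconnected (E ∪ B ∪ F') :=
    ((hc.isPreconnected_left h.preconnected_left).union a hc.mem_left haB
      h.preconnected_right).union b (Or.inr hbB) hd.mem_right
      (hd.isPreconnected_right h.preconnected_left)
  obtain ⟨r, ⟨hrF, hrE⟩, hr⟩ := isPreconnected_closed_iff.1 hM P Q hP hQ
    (by rw [hPQ]; exact subset_univ _) ⟨c, ⟨hcF', hEE hcE⟩, hcP⟩ ⟨d, ⟨hFF hdF', hdE'⟩, hdQ⟩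
  obtain ⟨s, hs, hs'⟩ := isPreconnected_closed_iff.1 hN P Q hP hQ
    (by rw [hPQ]; exact subset_univ _) ⟨c, Or.inl (Or.inl hcE), hcP⟩ ⟨d, Or.inr hdF', hdQ⟩
  have hrc : r ≠ c := fun e => hcQ (e ▸ hr.2)
  have hrd : r ≠ d := fun e => hdP (e ▸ hr.1)
  have hsc : s ≠ c := fun e => hcQ (e ▸ hs'.2)
  have hsd : s ≠ d := fun e => hdP (e ▸ hs'.1)
  have hMN : ∀ z, z ∈ F → z ∈ E' → z ∈ E ∪ B ∪ F' → z = c ∨ z = d := by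
    rintro z hzF hzE ((hz | hz) | hz)
    · exact Or.inl (hc.eq_of_mem hz hzF)
    · have hz' : z ∈ ({a, b} : Set X) := h.inter_eq.le ⟨hc.right_subset hzF, hz⟩
      rcases hz' with rfl | rfl
      · exact Or.inl (hc.eq_of_mem hc.mem_left hzF)
      · exact Or.inr (hd.eq_of_mem hzE hd.mem_right)
    · exact Or.inr (hd.eq_of_mem hzE hz)
  have hsM : ¬(s ∈ F ∧ s ∈ E') := fun hz => (hMN s hz.1 hz.2 hs).elim hsc hsd
  have huniq : ∀ z, z ∈ F → z ∈ E' → z ∈ P → z ∈ Q → z = r := by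
    intro z hzF hzE hzP hzQ
    have h1 : z ∈ ({p, q} : Set X) := hPQ'.le ⟨hzP, hzQ⟩
    have h2 : r ∈ ({p, q} : Set X) := hPQ'.le hr
    have h3 : s ∈ ({p, q} : Set X) := hPQ'.le hs'
    grind
  have hEF : ∀ z, z ∈ E → z ∉ F' := fun z hz hz' =>
    hcF (hc.eq_of_mem hz (hFF hz') ▸ hz')
  refine ⟨r, E ∪ (F ∩ E' ∩ P), F' ∪ (F ∩ E' ∩ Q), ⟨?_, ?_, ?_, ?_, Or.inl hc.mem_left,
    Or.inl hd.mem_right⟩, hrF, hrE, hrc, hrd⟩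
  · exact hc.closed_left.union ((hc.closed_right.inter hd.closed_left).inter hP)
  · exact hd.closed_right.union ((hc.closed_right.inter hd.closed_left).inter hQ)
  · ext z
    have h1 := hc.union_eq
    have h2 := hd.union_eq
    have h3 : z ∈ P ∪ Q := hPQ.ge (mem_univ z)
    grind
  · ext z
    have h1 : z ∈ E → z ∈ F → z = c := hc.eq_of_mem
    have h2 : z ∈ E' → z ∈ F' → z = d := hd.eq_of_mem
    have h3 := huniq z
    have h4 := hEF z
    have h5 := hr.1
    have h6 := hr.2
    grind

/-- Among the splittings that have a non-splitting point `x` on the right, one is the last. -/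
theorem exists_last (h : CircularCover a b A B) (hsep : PairSeparated X) (hxA : x ∈ A)
    (hx : ∀ E F, ¬SplitsAt A a b x E F) (hne : ∃ c E F, SplitsAt A a b c E F ∧ x ∈ F) :
    ∃ c E F, SplitsAt A a b c E F ∧ x ∈ F ∧
      ∀ d E' F', SplitsAt A a b d E' F' → x ∈ F' → d ∈ E := by
  by_contra! hcon
  have hA := h.preconnected_left
  have hnext : ∀ c E F, SplitsAt A a b c E F → x ∈ F → ∃ d E' F', SplitsAt A a b d E' F' ∧
      x ∈ F' ∧ d ∉ E ∧ E ⊆ E' ∧ F' ⊆ F := by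
    intro c E F hc hxF
    obtain ⟨d, E', F', hd, hxF', hdE⟩ := hcon c E F hc hxF
    obtain ⟨h1, h2, -⟩ := hc.nested hd hA hdE
    exact ⟨d, E', F', hd, hxF', hdE, h1, h2⟩
  set W : Set X := {z | ∃ c E F, SplitsAt A a b c E F ∧ x ∈ F ∧ z ∈ E} with hW
  have hWA : W ⊆ A := by
    rintro z ⟨c, E, F, hc, -, hz⟩
    exact hc.left_subset hz
  have hxW : x ∉ W := by
    rintro ⟨c, E, F, hc, hxF, hz⟩
    obtain rfl := hc.eq_of_mem hz hxF
    exact hx _ _ hc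
  have hstrict : ∀ z ∈ W, ∃ c E F, SplitsAt A a b c E F ∧ x ∈ F ∧ z ∈ E ∧ z ∉ F := by
    rintro z ⟨c, E, F, hc, hxF, hz⟩
    obtain ⟨d, E', F', hd, hxF', hdE, hEE, -⟩ := hnext c E F hc hxF
    exact ⟨d, E', F', hd, hxF', hEE hz, fun hz' => hdE (hd.eq_of_mem (hEE hz) hz' ▸ hz)⟩
  have hclosed : IsClosed (A \ W) := by
    have : A \ W = ⋂ i : {F : Set X // ∃ c E, SplitsAt A a b c E F ∧ x ∈ F}, i.1 := by
      ext z
      simp only [mem_sdiff, mem_iInter, Subtype.forall]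
      constructor
      · rintro ⟨hzA, hzW⟩ F ⟨c, E, hc, hxF⟩
        exact (hc.mem_or hzA).resolve_left fun hz => hzW ⟨c, E, F, hc, hxF, hz⟩
      · intro hz
        obtain ⟨c, E, F, hc, hxF⟩ := hne
        refine ⟨hc.right_subset (hz F ⟨c, E, hc, hxF⟩), fun hzW => ?_⟩
        obtain ⟨d, E', F', hd, hxF', -, hz'⟩ := hstrict z hzW
        exact hz' (hz F' ⟨d, E', hd, hxF'⟩)
    rw [this]
    exact isClosed_iInter fun ⟨F, c, E, hc, _⟩ => hc.closed_right
  have haW : a ∈ W := by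
    obtain ⟨c, E, F, hc, hxF⟩ := hne
    exact ⟨c, E, F, hc, hxF, hc.mem_left⟩
  have hbW : b ∉ W := by
    intro hb
    obtain ⟨c, E, F, hc, -, -, hbF⟩ := hstrict b hb
    exact hbF hc.mem_right
  have hupper : ∀ z ∈ W, ∀ c E F, SplitsAt A a b c E F → x ∈ F → ∃ d E' F',
      SplitsAt A a b d E' F' ∧ x ∈ F' ∧ E ⊆ E' ∧ F' ⊆ F ∧ z ∈ E' ∧ z ∉ F' := by
    intro z hz c E F hc hxF
    obtain ⟨d, E', F', hd, hxF', hzE, hzF⟩ := hstrict z hz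
    obtain ⟨e, G, H, he, hxH, h1, h2, h3, h4⟩ := hc.exists_upper hd hA hxF hxF'
    exact ⟨e, G, H, he, hxH, h1, h3, h2 hzE, fun hzH => hzF (h4 hzH)⟩
  have hbeyond : ∀ p q : X, ∃ c E F, SplitsAt A a b c E F ∧ x ∈ F ∧
      (p ∈ W → p ∉ F) ∧ (q ∈ W → q ∉ F) := by
    intro p q
    have hone : ∀ (p c : X) (E F : Set X), SplitsAt A a b c E F → x ∈ F → ∃ d E' F',
        SplitsAt A a b d E' F' ∧ x ∈ F' ∧ F' ⊆ F ∧ (p ∈ W → p ∉ F') := by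
      intro p c E F hc hxF
      by_cases hp : p ∈ W
      · obtain ⟨d, E', F', hd, hxF', -, hs, -, hpF⟩ := hupper p hp c E F hc hxF
        exact ⟨d, E', F', hd, hxF', hs, fun _ => hpF⟩
      · exact ⟨c, E, F, hc, hxF, Subset.rfl, fun hp' => absurd hp' hp⟩
    obtain ⟨c, E, F, hc, hxF⟩ := hne
    obtain ⟨c₁, E₁, F₁, hc₁, hxF₁, -, hp⟩ := hone p c E F hc hxF
    obtain ⟨c₂, E₂, F₂, hc₂, hxF₂, hs, hq⟩ := hone q c₁ E₁ F₁ hc₁ hxF₁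
    exact ⟨c₂, E₂, F₂, hc₂, hxF₂, fun hpW hpF => hp hpW (hs hpF), hq⟩
  have hfrontier : ∀ u v, u ∈ closure W → v ∈ closure W → u ∉ W → v ∉ W → u = v := by
    intro u v hu hv huW hvW
    by_contra huv
    obtain ⟨p, q, P, Q, hP, hQ, hPQ, hPQ', huQ, hvP⟩ := hsep u v huv
    obtain ⟨c, E, F, hc, hxF, hp, hq⟩ := hbeyond p q
    have hEW : E ⊆ W := fun z hz => ⟨c, E, F, hc, hxF, hz⟩
    set T : Set X := ⋃₀ {M | ∃ d E' F', SplitsAt A a b d E' F' ∧ x ∈ F' ∧ E ⊆ E' ∧ F' ⊆ F ∧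
      M = F ∩ E'} with hT
    have hTconn : IsPreconnected T := by
      refine isPreconnected_sUnion c _ ?_ ?_
      · rintro M ⟨d, E', F', hd, -, hEE, -, rfl⟩
        exact ⟨hc.mem_right_self, hEE hc.mem_left_self⟩
      · rintro M ⟨d, E', F', hd, -, -, hFF, rfl⟩
        exact hc.isPreconnected_inter hd hA hFF
    have hTF : T ⊆ F := by
      rintro z ⟨M, ⟨d, E', F', hd, -, -, -, rfl⟩, hz⟩
      exact hz.1
    have hTW : T ⊆ W := by
      rintro z ⟨M, ⟨d, E', F', hd, hxF', -, -, rfl⟩, hz⟩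
      exact ⟨d, E', F', hd, hxF', hz.2⟩
    have hWT : W ⊆ E ∪ T := by
      intro z hz
      obtain ⟨d, E', F', hd, hxF', h1, h2, h3, -⟩ := hupper z hz c E F hc hxF
      rcases hc.mem_or (hWA hz) with hzE | hzF
      · exact Or.inl hzE
      · exact Or.inr ⟨_, ⟨d, E', F', hd, hxF', h1, h2, rfl⟩, hzF, h3⟩
    have hlim : ∀ w ∈ closure W, w ∉ W → w ∈ closure T := by
      intro w hw hwW
      have hw' := closure_mono hWT hw
      rw [closure_union, hc.closed_left.closure_eq] at hw'
      exact hw'.resolve_left fun hwE => hwW (hEW hwE)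
    have hdisj : T ∩ (P ∩ Q) = ∅ := by
      rw [hPQ', eq_empty_iff_forall_notMem]
      rintro z ⟨hzT, rfl | rfl⟩
      · exact hp (hTW hzT) (hTF hzT)
      · exact hq (hTW hzT) (hTF hzT)
    rcases isPreconnected_iff_subset_of_disjoint_closed.1 hTconn P Q hP hQ
      (by rw [hPQ]; exact subset_univ _) hdisj with hs | hs
    · exact hvP (closure_minimal hs hP (hlim v hv hvW))
    · exact huQ (closure_minimal hs hQ (hlim u hu huW))
  have hclA : closure W ⊆ A := closure_minimal hWA h.closed_left
  obtain ⟨y, -, hyW, hyA⟩ := isPreconnected_closed_iff.1 hA (closure W) (A \ W) isClosed_closure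
    hclosed (fun z hz => by
      by_cases hzW : z ∈ W
      · exact Or.inl (subset_closure hzW)
      · exact Or.inr ⟨hz, hzW⟩)
    ⟨a, h.mem_left, subset_closure haW⟩ ⟨b, h.mem_right, h.mem_right, hbW⟩
  have hy : SplitsAt A a b y (closure W) (A \ W) := by
    refine ⟨isClosed_closure, hclosed, ?_, ?_, subset_closure haW, h.mem_right, hbW⟩
    · apply Subset.antisymm (union_subset hclA sdiff_subset)
      intro z hz
      by_cases hzW : z ∈ W
      · exact Or.inl (subset_closure hzW)
      · exact Or.inr ⟨hz, hzW⟩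
    · apply Subset.antisymm
      · rintro z ⟨hz, -, hzW⟩
        exact hfrontier z y hz hyW hzW hyA.2
      · rintro z rfl
        exact ⟨hyW, hyA⟩
  obtain ⟨d, E', F', hd, hxF', hdcl⟩ := hcon _ _ _ hy ⟨hxA, hxW⟩
  exact hdcl (subset_closure ⟨d, E', F', hd, hxF', hd.mem_left_self⟩)

theorem exists_splitsAt [T1Space X] (h : CircularCover a b A B) (hcut : NoClosedCut X)
    (hsep : PairSeparated X) (hxA : x ∈ A) : ∃ E F, SplitsAt A a b x E F := by
  by_contra! hx
  have hA := h.preconnected_left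
  have ha : SplitsAt A a b a {a} A :=
    ⟨isClosed_singleton, h.closed_left, by simp [h.mem_left], by simp [h.mem_left], rfl,
      h.mem_right⟩
  have hb : SplitsAt A a b b A {b} :=
    ⟨h.closed_left, isClosed_singleton, by simp [h.mem_right], by simp [h.mem_right], h.mem_left,
      rfl⟩
  obtain ⟨c, E, F, hc, hxF, hlast⟩ := h.exists_last hsep hxA hx ⟨a, _, _, ha, hxA⟩
  obtain ⟨d, F', E', hd, hxE', hfirst⟩ := h.swap.exists_last hsep hxA
    (fun E F hEF => hx _ _ hEF.symm) ⟨b, _, _, hb.symm, hxA⟩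
  have hd' := hd.symm
  have hxc : x ≠ c := fun e => hx _ _ (e ▸ hc)
  have hxd : x ≠ d := fun e => hx _ _ (e ▸ hd')
  rcases hc.trichotomy hd' hA with rfl | hdE | hcE
  · have h1 := hcut c (F ∩ E') (E ∪ F' ∪ B) (hc.closed_right.inter hd'.closed_left)
      ((hc.closed_left.union hd'.closed_right).union h.closed_right)
      (by
        rw [← h.union_eq]
        have h1 := hc.union_eq
        have h2 := hd'.union_eq
        ext z
        grind)
      (by
        rintro z ⟨⟨hzF, hzE⟩, (hz | hz) | hz⟩
        · exact hc.eq_of_mem hz hzF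
        · exact hd'.eq_of_mem hzE hz
        · have hz' : z ∈ ({a, b} : Set X) := h.inter_eq.le ⟨hc.right_subset hzF, hz⟩
          rcases hz' with rfl | rfl
          · exact hc.eq_of_mem hc.mem_left hzF
          · exact hd'.eq_of_mem hzE hd'.mem_right)
    rcases h1 with h1 | h1
    · exact hxc (h1 ⟨hxF, hxE'⟩)
    · have e1 : a = c := h1 (Or.inl (Or.inl hc.mem_left))
      have e2 : b = c := h1 (Or.inl (Or.inr hd'.mem_right))
      exact h.ne (e1.trans e2.symm)
  · obtain ⟨p, G, H, hp, hpF, hpE, hpc, hpd⟩ := h.exists_between hsep hc hd' hdE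
    rcases hp.mem_or hxA with hxG | hxH
    · exact hpd (hd'.eq_of_mem hpE (hfirst p H G hp.symm hxG))
    · exact hpc (hc.eq_of_mem (hlast p G H hp hxH) hpF)
  · obtain ⟨hs, -, -⟩ := hd'.nested hc hA hcE
    exact hxc (hc.eq_of_mem (hs hxE') hxF)

end CircularCover

end Splitting

section Arc

theorem exists_strictMono_continuous_of_separable {Y : Type*} [LinearOrder Y] [BoundedOrder Y]
    [Nontrivial Y] [TopologicalSpace Y] [ClosedIicTopology Y] [ClosedIciTopology Y]
    [PreconnectedSpace Y] [TopologicalSpace.SeparableSpace Y] :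
    ∃ f : Y → ℝ, StrictMono f ∧ Continuous f ∧ f ⊥ = 0 ∧ f ⊤ = 1 := by
  obtain ⟨D, hDc, hD⟩ := TopologicalSpace.exists_countable_dense Y
  have hIoo : ∀ x y : Y, x < y → (Ioo x y).Nonempty := by
    intro x y hxy
    obtain ⟨z, -, hz, hz'⟩ := isPreconnected_univ (α := Y) (Iio y) (Ioi x) isOpen_Iio isOpen_Ioi
      (fun z _ => lt_or_ge z y |>.imp id fun h => hxy.trans_le h)
      ⟨x, mem_univ x, hxy⟩ ⟨y, mem_univ y, hxy⟩
    exact ⟨z, hz', hz⟩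
  have hIooS : ∀ x y : Y, x < y → ∃ d : ↥(D ∩ Ioo ⊥ ⊤), x < d ∧ d < y := by
    intro x y hxy
    obtain ⟨d, hd, hdD⟩ := hD.inter_open_nonempty (Ioo x y)
      (isOpen_Ioi.inter isOpen_Iio) (hIoo x y hxy)
    exact ⟨⟨d, hdD, bot_le.trans_lt hd.1, hd.2.trans_le le_top⟩, hd.1, hd.2⟩
  have : Countable ↥(D ∩ Ioo ⊥ ⊤) := (hDc.mono inter_subset_left).to_subtype
  have : Nonempty ↥(D ∩ Ioo ⊥ ⊤) := ⟨(hIooS ⊥ ⊤ bot_lt_top).choose⟩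
  have : DenselyOrdered ↥(D ∩ Ioo ⊥ ⊤) :=
    ⟨fun d e hde => (hIooS d e hde).imp fun _ h => ⟨h.1, h.2⟩⟩
  have : NoMinOrder ↥(D ∩ Ioo ⊥ ⊤) :=
    ⟨fun d => (hIooS ⊥ d d.2.2.1).imp fun _ h => h.2⟩
  have : NoMaxOrder ↥(D ∩ Ioo ⊥ ⊤) :=
    ⟨fun d => (hIooS d ⊤ d.2.2.2).imp fun _ h => h.1⟩
  have : Nonempty (Ioo (0 : ℚ) 1) := ⟨⟨1 / 2, by norm_num, by norm_num⟩⟩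
  obtain ⟨φ⟩ := Order.iso_of_countable_dense ↥(D ∩ Ioo ⊥ ⊤) (Ioo (0 : ℚ) 1)
  let g : ↥(D ∩ Ioo ⊥ ⊤) → ℝ := fun d => ((φ d : ℚ) : ℝ)
  have hg : StrictMono g := fun d e hde => Rat.cast_lt.2 (φ.strictMono hde)
  have hg0 : ∀ d, 0 < g d := fun d => Rat.cast_pos.2 (φ d).2.1
  have hg1 : ∀ d, g d < 1 := fun d =>
    (Rat.cast_lt.2 (φ d).2.2).trans_eq Rat.cast_one
  have hgd : ∀ s t : ℝ, s < t → 0 < t → s < 1 → ∃ d, s < g d ∧ g d < t := by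
    intro s t hst ht hs
    obtain ⟨q, hq, hq'⟩ := exists_rat_btwn (show max s 0 < min t 1 by simp [*])
    rw [max_lt_iff] at hq
    rw [lt_min_iff] at hq'
    refine ⟨φ.symm ⟨q, by exact_mod_cast hq.2, by exact_mod_cast hq'.2⟩, ?_⟩
    simpa [g] using ⟨hq.1, hq'.1⟩
  let f : Y → ℝ := fun y => sSup (insert 0 (g '' {d | ↑d ≤ y}))
  have hbdd : ∀ y : Y, BddAbove (insert 0 (g '' {d | ↑d ≤ y})) := by
    intro y
    refine ⟨1, ?_⟩
    rintro _ (rfl | ⟨d, -, rfl⟩)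
    exacts [zero_le_one, (hg1 d).le]
  have hf0 : ∀ y, 0 ≤ f y := fun y => le_csSup (hbdd y) (mem_insert _ _)
  have hle : ∀ (d : ↥(D ∩ Ioo ⊥ ⊤)) y, ↑d ≤ y → g d ≤ f y := fun d y hd =>
    le_csSup (hbdd y) (mem_insert_of_mem _ ⟨d, hd, rfl⟩)
  have hf_le : ∀ y (t : ℝ), 0 ≤ t → (∀ d : ↥(D ∩ Ioo ⊥ ⊤), ↑d ≤ y → g d ≤ t) → f y ≤ t := by
    intro y t ht h
    refine csSup_le (insert_nonempty _ _) ?_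
    rintro _ (rfl | ⟨d, hd, rfl⟩)
    exacts [ht, h d hd]
  have hge : ∀ (d : ↥(D ∩ Ioo ⊥ ⊤)) y, y ≤ ↑d → f y ≤ g d := fun d y hd =>
    hf_le y _ (hg0 d).le fun e he => hg.monotone (he.trans hd)
  have hf1 : ∀ y, f y ≤ 1 := fun y => hf_le y 1 zero_le_one fun d _ => (hg1 d).le
  refine ⟨f, ?_, ?_, ?_, ?_⟩
  · intro x y hxy
    obtain ⟨d, hxd, hdy⟩ := hIooS x y hxy
    obtain ⟨e, hde, hey⟩ := hIooS d y hdy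
    exact (hge d x hxd.le).trans_lt ((hg hde).trans_le (hle e y hey.le))
  · rw [OrderTopology.continuous_iff]
    refine fun t => ⟨isOpen_iff_mem_nhds.2 fun y hy => ?_, isOpen_iff_mem_nhds.2 fun y hy => ?_⟩
    · rcases lt_or_ge t 0 with ht | ht
      · exact Filter.univ_mem' fun z => ht.trans_le (hf0 z)
      · obtain ⟨d, hd, htd⟩ : ∃ d : ↥(D ∩ Ioo ⊥ ⊤), ↑d ≤ y ∧ t < g d := by
          by_contra! hcon
          exact (hf_le y t ht hcon).not_gt hy
        obtain ⟨e, hte, hed⟩ := hgd t (g d) htd (hg0 d) (htd.trans (hg1 d))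
        have hey : (e : Y) < y := lt_of_lt_of_le (hg.lt_iff_lt.1 hed) hd
        filter_upwards [Ioi_mem_nhds hey] with z hz
        exact hte.trans_le (hle e z (le_of_lt hz))
    · rcases lt_or_ge 1 t with ht | ht
      · exact Filter.univ_mem' fun z => (hf1 z).trans_lt ht
      · obtain ⟨d, hd, hdt⟩ := hgd (f y) t hy ((hf0 y).trans_lt hy) (lt_of_lt_of_le hy ht)
        have hyd : y < d := not_le.1 fun h => (hle d y h).not_gt hd
        filter_upwards [Iio_mem_nhds hyd] with z hz
        exact (hge d z (le_of_lt hz)).trans_lt hdt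
  · exact le_antisymm (hf_le _ 0 le_rfl fun d hd => absurd hd d.2.2.1.not_ge) (hf0 _)
  · refine le_antisymm (hf1 _) (not_lt.1 fun h => ?_)
    obtain ⟨d, hd, -⟩ := hgd _ 1 h one_pos h
    exact (hle d ⊤ le_top).not_gt hd

theorem exists_arc_parametrization {Y : Type*} [TopologicalSpace Y] [PreconnectedSpace Y]
    [TopologicalSpace.SeparableSpace Y] {a b : Y} (hab : a ≠ b)
    (h : ∀ x : Y, ∃ E F, SplitsAt univ a b x E F) :
    ∃ f : Y → ℝ, Continuous f ∧ Function.Injective f ∧ range f = Icc 0 1 ∧ f a = 0 ∧ f b = 1 := by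
  classical
  choose E F h using h
  have hY : IsPreconnected (univ : Set Y) := isPreconnected_univ
  have hsub : ∀ {x y}, y ∉ E x → E x ⊆ E y := fun {x y} hy =>
    (h x).left_subset_left (h y) hY hy
  let _ : LinearOrder Y :=
    { le := fun x y => x ∈ E y
      le_refl := fun x => (h x).mem_left_self
      le_trans := by
        intro x y z hxy hyz
        rcases (h y).trichotomy (h z) hY with rfl | hz | hy
        · exact hxy
        · exact hsub hz hxy
        · exact absurd hyz hy
      le_antisymm := by
        intro x y hxy hyx
        rcases (h x).trichotomy (h y) hY with rfl | hy | hx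
        exacts [rfl, absurd hyx hy, absurd hxy hx]
      le_total := by
        intro x y
        by_cases hxy : x ∈ E y
        · exact Or.inl hxy
        · exact Or.inr (hsub hxy (h y).mem_left_self)
      toDecidableLE := Classical.decRel _ }
  have hle : ∀ x y : Y, x ≤ y ↔ x ∈ E y := fun x y => Iff.rfl
  have hge : ∀ x y : Y, x ≤ y ↔ y ∈ F x := by
    intro x y
    rw [hle]
    constructor
    · intro hxy
      rcases (h x).trichotomy (h y) hY with rfl | hy | hx
      · exact (h x).mem_right_self
      · exact ((h x).mem_or (mem_univ y)).resolve_left hy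
      · exact absurd hxy hx
    · intro hy
      by_cases hyE : y ∈ E x
      · rw [(h x).eq_of_mem hyE hy]
        exact (h x).mem_left_self
      · exact hsub hyE (h x).mem_left_self
  have : ClosedIicTopology Y := ⟨fun x => (h x).closed_left⟩
  have : ClosedIciTopology Y := ⟨fun x => by
    convert (h x).closed_right
    ext y
    exact hge x y⟩
  let _ : BoundedOrder Y :=
    { bot := a
      top := b
      bot_le := fun x => (h x).mem_left
      le_top := fun x => (hge x b).2 (h x).mem_right }
  have : Nontrivial Y := ⟨a, b, hab⟩
  obtain ⟨f, hf, hfc, hf0, hf1⟩ := exists_strictMono_continuous_of_separable (Y := Y)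
  refine ⟨f, hfc, hf.injective, Subset.antisymm ?_ ?_, hf0, hf1⟩
  · rintro _ ⟨y, rfl⟩
    exact ⟨hf0 ▸ hf.monotone bot_le, hf1 ▸ hf.monotone le_top⟩
  · exact (isPreconnected_range hfc).Icc_subset ⟨_, hf0⟩ ⟨_, hf1⟩

end Arc

section Gluing

variable {X : Type*} [TopologicalSpace X]

theorem CircularCover.exists_parametrization [T1Space X] [SecondCountableTopology X] {a b : X}
    {A B : Set X} (h : CircularCover a b A B) (hcut : NoClosedCut X) (hsep : PairSeparated X) :
    ∃ f : X → ℝ, ContinuousOn f A ∧ InjOn f A ∧ f '' A = Icc 0 1 ∧ f a = 0 ∧ f b = 1 := by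
  have : PreconnectedSpace A := isPreconnected_iff_preconnectedSpace.1 h.preconnected_left
  have hsplit : ∀ x : A, ∃ E F, SplitsAt univ (⟨a, h.mem_left⟩ : A) ⟨b, h.mem_right⟩ x E F := by
    intro x
    obtain ⟨E, F, hx⟩ := h.exists_splitsAt hcut hsep x.2
    refine ⟨Subtype.val ⁻¹' E, Subtype.val ⁻¹' F, hx.closed_left.preimage continuous_subtype_val,
      hx.closed_right.preimage continuous_subtype_val, ?_, ?_, hx.mem_left, hx.mem_right⟩
    · exact eq_univ_of_forall fun y => hx.mem_or y.2
    · ext y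
      rw [← preimage_inter, hx.inter_eq]
      exact Subtype.ext_iff.symm
  obtain ⟨g, hg, hinj, hrange, ha, hb⟩ := exists_arc_parametrization
    (by simpa [Subtype.ext_iff] using h.ne) hsplit
  have hext : ∀ x : A, Function.extend (Subtype.val : A → X) g 0 (x : X) = g x :=
    Subtype.val_injective.extend_apply g (0 : X → ℝ)
  refine ⟨Function.extend (Subtype.val : A → X) g 0, ?_, ?_, ?_, ?_, ?_⟩
  · rw [continuousOn_iff_continuous_domRestrict]
    exact hg.congr fun x => (hext x).symm
  · intro x hx y hy hxy
    have := (hext ⟨x, hx⟩).symm.trans (hxy.trans (hext ⟨y, hy⟩))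
    exact congrArg Subtype.val (hinj this)
  · rw [← hrange]
    ext t
    constructor
    · rintro ⟨x, hx, rfl⟩
      exact ⟨⟨x, hx⟩, (hext ⟨x, hx⟩).symm⟩
    · rintro ⟨x, rfl⟩
      exact ⟨x, x.2, hext x⟩
  · exact (hext ⟨a, h.mem_left⟩).trans ha
  · exact (hext ⟨b, h.mem_right⟩).trans hb

theorem CircularCover.nonempty_homeomorph_circle [T1Space X] [SecondCountableTopology X]
    [CompactSpace X] {a b : X} {A B : Set X} (h : CircularCover a b A B) (hcut : NoClosedCut X)
    (hsep : PairSeparated X) : Nonempty (X ≃ₜ Circle) := by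
  classical
  obtain ⟨f, hfc, hfi, hfr, hfa, hfb⟩ := h.exists_parametrization hcut hsep
  obtain ⟨g, hgc, hgi, hgr, hga, hgb⟩ := h.symm.exists_parametrization hcut hsep
  have hπ := Real.pi_pos
  let k : X → Circle := fun x =>
    if x ∈ A then Circle.exp (Real.pi * f x) else Circle.exp (-(Real.pi * g x))
  have hkA : ∀ x ∈ A, k x = Circle.exp (Real.pi * f x) := fun x hx => if_pos hx
  have hkA' : ∀ x, x ∉ A → k x = Circle.exp (-(Real.pi * g x)) := fun x hx => if_neg hx
  have hmem : ∀ x, x ∉ A → x ∈ B := fun x => (h.union_eq.ge (mem_univ x)).resolve_left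
  have hkB : ∀ x ∈ B, k x = Circle.exp (-(Real.pi * g x)) := by
    intro x hx
    by_cases hxA : x ∈ A
    · rw [hkA x hxA]
      have hxab : x ∈ ({a, b} : Set X) := h.inter_eq.le ⟨hxA, hx⟩
      rcases hxab with rfl | rfl
      · simp [hfa, hga]
      · rw [hfb, hgb, Circle.exp_eq_exp]
        exact ⟨1, by push_cast; ring⟩
    · exact hkA' x hxA
  have hfI : ∀ x ∈ A, f x ∈ Icc (0 : ℝ) 1 := fun x hx => hfr ▸ mem_image_of_mem f hx
  have hgI : ∀ x, x ∉ A → 0 < g x ∧ g x < 1 := by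
    intro x hx
    have hxB := hmem x hx
    have hI : g x ∈ Icc (0 : ℝ) 1 := hgr ▸ mem_image_of_mem g hxB
    refine ⟨lt_of_le_of_ne hI.1 fun e => ?_, lt_of_le_of_ne hI.2 fun e => ?_⟩
    · exact hx (hgi h.symm.mem_left hxB (hga.trans e) ▸ h.mem_left)
    · exact hx (hgi hxB h.symm.mem_right (e.trans hgb.symm) ▸ h.mem_right)
  have hargA : ∀ x ∈ A, Complex.arg (k x) = Real.pi * f x := by
    intro x hx
    obtain ⟨h0, h1⟩ := hfI x hx
    rw [hkA x hx, Circle.arg_exp] <;> nlinarith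
  have hargB : ∀ x, x ∉ A → Complex.arg (k x) = -(Real.pi * g x) := by
    intro x hx
    obtain ⟨h0, h1⟩ := hgI x hx
    rw [hkA' x hx, Circle.arg_exp] <;> nlinarith
  have hneg : ∀ x, x ∉ A → Complex.arg (k x) < 0 := by
    intro x hx
    rw [hargB x hx]
    exact neg_neg_of_pos (mul_pos hπ (hgI x hx).1)
  have hnonneg : ∀ x ∈ A, 0 ≤ Complex.arg (k x) := by
    intro x hx
    rw [hargA x hx]
    exact mul_nonneg hπ.le (hfI x hx).1
  have hcont : Continuous k := by
    rw [← continuousOn_univ, ← h.union_eq]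
    refine ContinuousOn.union_of_isClosed ?_ ?_ h.closed_left h.closed_right
    · exact (Circle.exp.continuous.comp_continuousOn (continuousOn_const.mul hfc)).congr hkA
    · exact (Circle.exp.continuous.comp_continuousOn (continuousOn_const.mul hgc).neg).congr hkB
  have hinj : Function.Injective k := by
    intro x y hxy
    have harg : Complex.arg (k x) = Complex.arg (k y) := by rw [hxy]
    by_cases hx : x ∈ A <;> by_cases hy : y ∈ A
    · rw [hargA x hx, hargA y hy] at harg
      exact hfi hx hy (mul_left_cancel₀ hπ.ne' harg)
    · exact absurd harg ((hneg y hy).trans_le (hnonneg x hx)).ne'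
    · exact absurd harg ((hneg x hx).trans_le (hnonneg y hy)).ne
    · rw [hargB x hx, hargB y hy, neg_inj] at harg
      exact hgi (hmem x hx) (hmem y hy) (mul_left_cancel₀ hπ.ne' harg)
  have hsurj : Function.Surjective k := by
    intro z
    have hle := Complex.arg_le_pi (z : ℂ)
    have hlt := Complex.neg_pi_lt_arg (z : ℂ)
    rcases le_or_gt 0 (Complex.arg z) with hz | hz
    · obtain ⟨x, hx, hxz⟩ : Complex.arg z / Real.pi ∈ f '' A := by
        rw [hfr]
        exact ⟨by positivity, (div_le_one hπ).2 hle⟩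
      refine ⟨x, ?_⟩
      rw [hkA x hx, hxz, mul_div_cancel₀ _ hπ.ne', Circle.exp_arg]
    · obtain ⟨x, hx, hxz⟩ : -Complex.arg z / Real.pi ∈ g '' B := by
        rw [hgr]
        exact ⟨div_nonneg (by linarith) hπ.le, (div_le_one hπ).2 (by linarith)⟩
      refine ⟨x, ?_⟩
      rw [hkB x hx, hxz, mul_div_cancel₀ _ hπ.ne', neg_neg, Circle.exp_arg]
  exact ⟨hcont.homeoOfEquivCompactToT2 (f := Equiv.ofBijective k ⟨hinj, hsurj⟩)⟩

theorem noClosedCut_of_not_cutPoint (hnc : ∀ p : X, ¬CutPoint p) : NoClosedCut X := by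
  intro p E F hE hF hun hin
  by_contra! hcon
  obtain ⟨⟨e, heE, he⟩, f, hfF, hf⟩ := And.imp not_subset.1 not_subset.1 hcon
  have hcover : ∀ z, z ∈ E ∨ z ∈ F := fun z => hun.ge (mem_univ z)
  have hmeet : ∀ z, z ∈ E → z ∈ F → z = p := fun z hz hz' => hin ⟨hz, hz'⟩
  refine hnc p ⟨Fᶜ ∩ {p}ᶜ, Eᶜ ∩ {p}ᶜ, ⟨Fᶜ, hF.isOpen_compl, rfl⟩, ⟨Eᶜ, hE.isOpen_compl, rfl⟩,
    ?_, ?_, ⟨e, fun h => he (hmeet e heE h), he⟩, ⟨f, fun h => hf (hmeet f h hfF), hf⟩⟩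
  · rw [disjoint_left]
    rintro z ⟨hzF, -⟩ ⟨hzE, -⟩
    exact (hcover z).elim hzE hzF
  · ext z
    have := hmeet z
    grind

theorem Separates.exists_closed_cover [T1Space X] {a b c d : X}
    (h : Separates ({a, b} : Set X) {c} {d}) : ∃ P Q : Set X, IsClosed P ∧ IsClosed Q ∧
      P ∪ Q = univ ∧ P ∩ Q = {a, b} ∧ c ∉ Q ∧ d ∉ P := by
  obtain ⟨U, V, ⟨⟨O, hO, hU⟩, ⟨O', hO', hV⟩, hdisj, hun, -, -⟩, hc, hd⟩ := h
  have hopen : IsOpen ({a, b}ᶜ : Set X) := ((finite_singleton b).insert a).isClosed.isOpen_compl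
  refine ⟨Vᶜ, Uᶜ, ?_, ?_, ?_, ?_, fun h => h (hc rfl), fun h => h (hd rfl)⟩
  · rw [isClosed_compl_iff, hV]
    exact hO'.inter hopen
  · rw [isClosed_compl_iff, hU]
    exact hO.inter hopen
  · rw [← compl_inter, inter_comm, hdisj.inter_eq, compl_empty]
  · rw [← compl_union, union_comm, hun, compl_compl]

end Gluing

theorem stmt9 {X : Type*} [MetricSpace X] [CompactSpace X] [ConnectedSpace X]
    [Nontrivial X] (hnc : ∀ p : X, ¬CutPoint p)
    (hsep : ∀ c d : X, c ≠ d →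
      ∃ a b : X, CutPair a b ∧ Separates ({a, b} : Set X) {c} {d}) :
    Nonempty (X ≃ₜ Circle) := by
  have hcut := noClosedCut_of_not_cutPoint hnc
  have hpair : PairSeparated X := by
    intro u v huv
    obtain ⟨a, b, -, hab⟩ := hsep u v huv
    exact ⟨a, b, hab.exists_closed_cover⟩
  obtain ⟨u, v, huv⟩ := exists_pair_ne X
  obtain ⟨a, b, ⟨hne, -⟩, hab⟩ := hsep u v huv
  obtain ⟨P, Q, hP, hQ, hun, hin, hu, hv⟩ := hab.exists_closed_cover
  have huP : u ∈ P := (hun.ge (mem_univ u)).resolve_right hu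
  have hvQ : v ∈ Q := (hun.ge (mem_univ v)).resolve_left hv
  have hP' : ¬P ⊆ {a, b} := fun h => hu (hin.ge (h huP)).2
  have hQ' : ¬Q ⊆ {a, b} := fun h => hv (hin.ge (h hvQ)).1
  have hcover : CircularCover a b P Q :=
    ⟨hne, hP, hQ, isPreconnected_of_noClosedCut hcut hP hQ hun hin hP' hQ',
      isPreconnected_of_noClosedCut hcut hQ hP (by rwa [union_comm]) (by rwa [inter_comm])
        hQ' hP', hun, hin⟩
  exact hcover.nonempty_homeomorph_circle hcut hpair
end

section
/- Let X be a continuum without cut points, S a necklace of X, and D a gap of S with sides B and C. Then B ∪ C is a nonsingleton inseparable subset of X. -/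
open Set

section Helpers

variable {X : Type*} [TopologicalSpace X]

/-- Removing a non-cut point leaves no partition into two nonempty open sets. -/
lemma not_cutPoint_partition [T1Space X] {p : X} (h : ¬CutPoint p) {U V : Set X}
    (hU : IsOpen U) (hV : IsOpen V) (hpU : p ∉ U) (hpV : p ∉ V)
    (hd : ∀ z ∈ U, z ∉ V) (hc : ∀ z, z ≠ p → z ∈ U ∨ z ∈ V)
    (hUn : U.Nonempty) (hVn : V.Nonempty) : False := by
  refine h ⟨U, V, ⟨U, hU, ?_⟩, ⟨V, hV, ?_⟩, Set.disjoint_left.2 hd, ?_, hUn, hVn⟩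
  · ext z
    simp only [mem_inter_iff, mem_compl_iff, mem_singleton_iff]
    exact ⟨fun hz => ⟨hz, fun e => hpU (e ▸ hz)⟩, fun hz => hz.1⟩
  · ext z
    simp only [mem_inter_iff, mem_compl_iff, mem_singleton_iff]
    exact ⟨fun hz => ⟨hz, fun e => hpV (e ▸ hz)⟩, fun hz => hz.1⟩
  · ext z
    simp only [mem_union, mem_compl_iff, mem_singleton_iff]
    refine ⟨?_, hc z⟩
    rintro (hz | hz) rfl
    exacts [hpU hz, hpV hz]

/-- A closed set whose frontier is contained in `{r, s}` stays connected after removing `r`. -/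
lemma isPreconnected_diff_end [T1Space X] (hnc : ∀ p : X, ¬CutPoint p) {D : Set X} {r s : X}
    (hD : IsClosed D) (hO : IsOpen (D \ {r, s})) (hs : s ∈ D) (hrs : r ≠ s) :
    IsPreconnected (D \ {r}) := by
  have key : ∀ u v : Set X, IsOpen u → IsOpen v → D \ {r} ⊆ u ∪ v → s ∈ u →
      ((D \ {r}) ∩ v).Nonempty → ((D \ {r}) ∩ (u ∩ v)).Nonempty := by
    intro u v hu hv hc hsu hvn
    by_contra hne
    have hdis : ∀ z ∈ D, z ≠ r → z ∈ u → z ∉ v := fun z h1 h2 h3 h4 =>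
      hne ⟨z, ⟨h1, h2⟩, h3, h4⟩
    refine not_cutPoint_partition (hnc r) (U := (D \ {r, s}) ∩ v) (V := {r}ᶜ ∩ (Dᶜ ∪ u))
      (hO.inter hv) (isOpen_compl_singleton.inter (hD.isOpen_compl.union hu)) ?_ ?_ ?_ ?_ ?_ ?_
    · simp
    · simp
    · rintro z ⟨⟨hz1, hz2⟩, hz3⟩ ⟨hz4, hz5⟩
      rcases hz5 with hz5 | hz5
      · exact hz5 hz1
      · exact hdis z hz1 hz4 hz5 hz3
    · intro z hz
      by_cases hzD : z ∈ D
      · rcases hc ⟨hzD, hz⟩ with h | h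
        · exact Or.inr ⟨hz, Or.inr h⟩
        · by_cases hzs : z = s
          · exact absurd h (hzs ▸ hdis s hs hrs.symm hsu)
          · exact Or.inl ⟨⟨hzD, by simp [hz, hzs]⟩, h⟩
      · exact Or.inr ⟨hz, Or.inl hzD⟩
    · obtain ⟨z, ⟨hz1, hz2⟩, hz3⟩ := hvn
      refine ⟨z, ⟨hz1, ?_⟩, hz3⟩
      rintro (h | h)
      · exact hz2 h
      · rw [mem_singleton_iff] at h
        subst h
        exact hdis z hs hz2 hsu hz3
    · exact ⟨s, hrs.symm, Or.inr hsu⟩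
  intro u v hu hv hc hun hvn
  rcases hc ⟨hs, hrs.symm⟩ with h | h
  · exact key u v hu hv hc h hvn
  · rw [inter_comm u v]
    exact key v u hv hu (by rwa [union_comm]) h hun

/-- A cyclic decomposition with pieces `P 0, …, P n`, indexed by natural numbers. -/
structure NatDec (n : ℕ) (x : ℕ → X) (P : ℕ → Set X) : Prop where
  two_le : 2 ≤ n
  inj : ∀ i j, i ≤ n → j ≤ n → x i = x j → i = j
  compact : ∀ i ≤ n, IsCompact (P i)
  conn : ∀ i ≤ n, IsConnected (P i)
  left : ∀ i ≤ n, x i ∈ P i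
  right : ∀ i < n, x (i + 1) ∈ P i
  last : x 0 ∈ P n
  meet : ∀ i j z, i < j → j ≤ n → z ∈ P i → z ∈ P j →
    (j = i + 1 ∧ z = x j) ∨ (i = 0 ∧ j = n ∧ z = x 0)
  cover : ∀ z, ∃ i ≤ n, z ∈ P i

/-- The set of division points of a decomposition. -/
def DecSet (A : Set X) : Prop :=
  ∃ (n : ℕ) (x : ℕ → X) (P : ℕ → Set X), NatDec n x P ∧ A = x '' Iic n

/-- `P` is a piece, with ends `s` and `t`, of a cyclic decomposition by the set `A`. -/
def Piece (A : Set X) (s t : X) (P : Set X) : Prop :=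
  ∃ (n : ℕ) (x : ℕ → X) (M : ℕ → Set X), NatDec n x M ∧ A = x '' Iic n ∧
    s = x n ∧ t = x 0 ∧ P = M n

lemma zmod_cast_inj {n a b : ℕ} (ha : a ≤ n) (hb : b ≤ n)
    (h : (a : ZMod (n + 1)) = b) : a = b := by
  rw [ZMod.natCast_eq_natCast_iff'] at h
  rwa [Nat.mod_eq_of_lt (by omega), Nat.mod_eq_of_lt (by omega)] at h

lemma CyclicDecomp.natDec {n : ℕ} {x : ZMod (n + 1) → X} {M : ZMod (n + 1) → Set X}
    (h : CyclicDecomp (n + 1) x M) (a : ZMod (n + 1)) :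
    NatDec n (fun k => x (a + k)) (fun k => M (a + k)) := by
  obtain ⟨h2, hinj, hM, hadj, hfar, hcov⟩ := h
  have hx : ∀ i, x (i + 1) ∈ M i ∧ x (i + 1) ∈ M (i + 1) := fun i => by
    have : x (i + 1) ∈ M i ∩ M (i + 1) := by rw [hadj]; rfl
    exact this
  have hwrap : a + (n : ZMod (n + 1)) + 1 = a := by
    have : ((n + 1 : ℕ) : ZMod (n + 1)) = 0 := ZMod.natCast_self _
    push_cast at this
    rw [add_assoc, this, add_zero]
  refine ⟨by omega, ?_, fun i _ => (hM _).1, fun i _ => (hM _).2, ?_, ?_, ?_, ?_, ?_⟩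
  · intro i j hi hj hij
    exact zmod_cast_inj hi hj (add_left_cancel (hinj hij))
  · intro i _
    have := (hx (a + i - 1)).2
    rwa [sub_add_cancel] at this
  · intro i _
    have := (hx (a + i)).1
    simpa [add_assoc] using this
  · have := (hx (a + n)).1
    rw [hwrap] at this
    simpa using this
  · intro i j z hij hj hzi hzj
    by_cases h1 : j = i + 1
    · left
      refine ⟨h1, ?_⟩
      have : z ∈ M (a + i) ∩ M (a + i + 1) := ⟨hzi, by subst h1; simpa [add_assoc] using hzj⟩
      rw [hadj] at this
      subst h1
      simpa [add_assoc] using this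
    by_cases h3 : i = 0 ∧ j = n
    · obtain ⟨rfl, rfl⟩ := h3
      right
      refine ⟨rfl, rfl, ?_⟩
      have : z ∈ M (a + j) ∩ M (a + j + 1) := ⟨hzj, by rw [hwrap]; simpa using hzi⟩
      rw [hadj, hwrap] at this
      simpa using this
    · exfalso
      have : z ∈ M (a + i) ∩ M (a + j) := ⟨hzi, hzj⟩
      rw [hfar] at this
      · exact this
      · intro e
        have := zmod_cast_inj (by omega) hj (add_left_cancel e)
        omega
      · intro e
        rw [add_assoc] at e
        have e' := add_left_cancel e
        have := zmod_cast_inj (n := n) (a := j) (b := i + 1) hj (by omega) (by push_cast; exact e')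
        omega
      · intro e
        rw [add_assoc] at e
        have e' := add_left_cancel e
        by_cases hjn : j = n
        · subst hjn
          have h0 : (j : ZMod (j + 1)) + 1 = 0 := by
            have : ((j + 1 : ℕ) : ZMod (j + 1)) = 0 := ZMod.natCast_self _
            exact_mod_cast this
          rw [h0] at e'
          have := zmod_cast_inj (n := j) (a := i) (b := 0) (by omega) (by omega)
            (by push_cast; exact e')
          omega
        · have := zmod_cast_inj (n := n) (a := i) (b := j + 1) (by omega) (by omega)
            (by push_cast; exact e')
          omega
  · intro z
    have : z ∈ ⋃ i, M i := by rw [hcov]; trivial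
    obtain ⟨i, hi⟩ := mem_iUnion.1 this
    refine ⟨(i - a).val, Nat.lt_succ_iff.1 (ZMod.val_lt _), ?_⟩
    simpa using hi

lemma range_eq_image_Iic {X : Type*} {n : ℕ} (x : ZMod (n + 1) → X) (a : ZMod (n + 1)) :
    range x = (fun k : ℕ => x (a + k)) '' Iic n := by
  ext z
  constructor
  · rintro ⟨i, rfl⟩
    exact ⟨(i - a).val, Nat.lt_succ_iff.1 (ZMod.val_lt _), by simp⟩
  · rintro ⟨k, _, rfl⟩
    exact ⟨_, rfl⟩

lemma range_val_eq_image_Iic {X : Type*} {n : ℕ} (x : ℕ → X) :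
    range (fun i : ZMod (n + 1) => x i.val) = x '' Iic n := by
  ext z
  constructor
  · rintro ⟨i, rfl⟩
    exact ⟨i.val, Nat.lt_succ_iff.1 (ZMod.val_lt _), rfl⟩
  · rintro ⟨k, hk, rfl⟩
    exact ⟨(k : ZMod (n + 1)), by
      simp only [ZMod.val_natCast]
      rw [Nat.mod_eq_of_lt (Nat.lt_succ_iff.2 hk)]⟩

lemma zmod_val_add_one {n : ℕ} (hn : 2 ≤ n) (i : ZMod (n + 1)) :
    (i.val < n ∧ (i + 1).val = i.val + 1) ∨ (i.val = n ∧ (i + 1).val = 0) := by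
  have hlt := ZMod.val_lt i
  have h1 : (1 : ZMod (n + 1)).val = 1 := by
    have : Fact (1 < n + 1) := ⟨by omega⟩
    exact ZMod.val_one _
  rw [ZMod.val_add, h1]
  by_cases h : i.val < n
  · exact Or.inl ⟨h, Nat.mod_eq_of_lt (by omega)⟩
  · have : i.val = n := by omega
    exact Or.inr ⟨this, by rw [this, Nat.mod_self]⟩

lemma NatDec.cyclicDecomp {n : ℕ} {x : ℕ → X} {P : ℕ → Set X} (h : NatDec n x P) :
    CyclicDecomp (n + 1) (fun i => x i.val) (fun i => P i.val) := by
  have h2 := h.two_le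
  have hle : ∀ i : ZMod (n + 1), i.val ≤ n := fun i => Nat.lt_succ_iff.1 (ZMod.val_lt _)
  refine ⟨by omega, ?_, fun i => ⟨h.compact _ (hle i), h.conn _ (hle i)⟩, ?_, ?_, ?_⟩
  · intro i j hij
    exact ZMod.val_injective _ (h.inj _ _ (hle i) (hle j) hij)
  · intro i
    ext z
    simp only [mem_inter_iff, mem_singleton_iff]
    rcases zmod_val_add_one h2 i with ⟨h3, h4⟩ | ⟨h3, h4⟩
    · rw [h4]
      constructor
      · rintro ⟨hz1, hz2⟩
        rcases h.meet _ _ z (Nat.lt_succ_self _) h3 hz1 hz2 with h5 | h5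
        · exact h5.2
        · omega
      · rintro rfl
        exact ⟨h.right _ h3, h.left _ h3⟩
    · rw [h4, h3]
      constructor
      · rintro ⟨hz1, hz2⟩
        rcases h.meet _ _ z (by omega) le_rfl hz2 hz1 with h5 | h5
        · omega
        · exact h5.2.2
      · rintro rfl
        exact ⟨h.last, h.left _ (by omega)⟩
  · have key : ∀ i j : ZMod (n + 1), i.val < j.val → j ≠ i + 1 → i ≠ j + 1 →
        P i.val ∩ P j.val = ∅ := by
      intro i j hij h3 h4
      rw [eq_empty_iff_forall_notMem]
      rintro z ⟨hz1, hz2⟩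
      rcases h.meet _ _ z hij (hle j) hz1 hz2 with ⟨h5, -⟩ | ⟨h5, h6, -⟩
      · apply h3
        apply ZMod.val_injective
        rcases zmod_val_add_one h2 i with ⟨_, h7⟩ | ⟨h8, h7⟩
        · omega
        · have := hle j
          omega
      · apply h4
        apply ZMod.val_injective
        rcases zmod_val_add_one h2 j with ⟨_, h7⟩ | ⟨h8, h7⟩
        · omega
        · omega
    intro i j hij h3 h4
    rcases lt_trichotomy i.val j.val with h5 | h5 | h5
    · exact key i j h5 h3 h4
    · exact absurd (ZMod.val_injective _ h5) hij
    · rw [inter_comm]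
      exact key j i h5 h4 h3
  · rw [eq_univ_iff_forall]
    intro z
    obtain ⟨i, hi, hz⟩ := h.cover z
    refine mem_iUnion.2 ⟨(i : ZMod (n + 1)), ?_⟩
    simp only [ZMod.val_natCast]
    rwa [Nat.mod_eq_of_lt (by omega)]

lemma CyclicDecomp.piece {n : ℕ} {x : ZMod (n + 1) → X} {M : ZMod (n + 1) → Set X}
    (h : CyclicDecomp (n + 1) x M) (i : ZMod (n + 1)) :
    Piece (range x) (x i) (x (i + 1)) (M i) := by
  have hw : i + 1 + (n : ZMod (n + 1)) = i := by
    have : ((n + 1 : ℕ) : ZMod (n + 1)) = 0 := ZMod.natCast_self _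
    push_cast at this
    rw [add_assoc, add_comm 1, this, add_zero]
  refine ⟨n, _, _, h.natDec (i + 1), range_eq_image_Iic x _, ?_, ?_, ?_⟩
  · simp only [hw]
  · simp
  · simp only [hw]

lemma NatDec.piece {n : ℕ} {x : ℕ → X} {P : ℕ → Set X} (h : NatDec n x P) {i : ℕ} (hi : i ≤ n) :
    ∃ t, Piece (x '' Iic n) (x i) t (P i) := by
  have := h.cyclicDecomp.piece (i : ZMod (n + 1))
  rw [range_val_eq_image_Iic] at this
  simp only [ZMod.val_natCast] at this
  rw [Nat.mod_eq_of_lt (by omega)] at this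
  exact ⟨_, this⟩

lemma NatDec.ncard_eq {n : ℕ} {x : ℕ → X} {P : ℕ → Set X} (h : NatDec n x P) :
    (x '' Iic n).ncard = n + 1 := by
  have hinj : InjOn x (Iic n) := fun a ha b hb e => h.inj a b ha hb e
  rw [hinj.ncard_image]
  simp [← Finset.coe_Iic, ncard_coe_finset]

lemma NatDec.rotate {n : ℕ} {x : ℕ → X} {P : ℕ → Set X} (h : NatDec n x P) {i : ℕ} (hi : i ≤ n) :
    ∃ x' P', NatDec n x' P' ∧ x '' Iic n = x' '' Iic n ∧ x' n = x i := by
  obtain ⟨t, m, x', P', h', hA, hs, -, -⟩ := h.piece hi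
  have hnm : m = n := by
    have h1 := h.ncard_eq
    have h2 := h'.ncard_eq
    rw [hA] at h1
    omega
  subst hnm
  exact ⟨x', P', h', hA, hs.symm⟩

lemma NatDec.insert {n : ℕ} {x : ℕ → X} {P : ℕ → Set X} (h : NatDec n x P) {c : X}
    {E G : Set X} (hc : c ∉ x '' Iic n) (hE : IsCompact E) (hG : IsCompact G)
    (hEc : IsConnected E) (hGc : IsConnected G) (hu : E ∪ G = P n) (hi : E ∩ G = {c})
    (hs : x n ∈ E) (ht : x 0 ∈ G) :
    NatDec (n + 1) (fun i => if i ≤ n then x i else c)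
      (fun i => if i < n then P i else if i = n then E else G) := by
  have h2 := h.two_le
  have hEP : E ⊆ P n := hu ▸ subset_union_left
  have hGP : G ⊆ P n := hu ▸ subset_union_right
  have hcEG : c ∈ E ∩ G := by rw [hi]; rfl
  have hx : ∀ i ≤ n, x i ≠ c := fun i hi e => hc ⟨i, hi, e⟩
  have hEG : ∀ z ∈ E, z ∈ G → z = c := fun z h1 h2 => by
    have : z ∈ E ∩ G := ⟨h1, h2⟩
    rwa [hi] at this
  constructor
  · omega
  · intro i j hin hjn hij
    split_ifs at hij with h3 h4 h4
    · exact h.inj i j h3 h4 hij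
    · exact absurd hij (hx i h3)
    · exact absurd hij.symm (hx j h4)
    · omega
  · intro i hin
    split_ifs with h3 h4
    exacts [h.compact i h3.le, hE, hG]
  · intro i hin
    split_ifs with h3 h4
    exacts [h.conn i h3.le, hEc, hGc]
  · intro i hin
    rcases (by omega : i < n ∨ i = n ∨ i = n + 1) with h3 | rfl | rfl
    · simpa [h3, h3.le] using h.left i h3.le
    · simpa using hs
    · simpa using hcEG.2
  · intro i hin
    rcases (by omega : i < n ∨ i = n) with h3 | rfl
    · have h4 : i + 1 ≤ n := h3
      simpa [h3, h4] using h.right i h3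
    · simpa using hcEG.1
  · simpa using ht
  · intro i j z hij hj hzi hzj
    have hi' : i ≤ n := by omega
    rcases (by omega : j < n ∨ j = n ∨ j = n + 1) with hjn | rfl | rfl
    · have hin : i < n := by omega
      simp only [hjn, hin, if_true] at hzi hzj
      simp only [hjn.le, if_true]
      rcases h.meet i j z hij hjn.le hzi hzj with h3 | h3
      · exact Or.inl h3
      · omega
    · simp only [hij, if_true, lt_irrefl, if_false] at hzi hzj
      simp only [le_refl, if_true]
      rcases h.meet i j z hij le_rfl hzi (hEP hzj) with h3 | h3
      · exact Or.inl h3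
      · exfalso
        have := hEG z hzj (h3.2.2 ▸ ht)
        exact hx 0 (by omega) (h3.2.2 ▸ this)
    · have h4 : ¬ (n + 1 < n) := by omega
      have h5 : ¬ (n + 1 = n) := by omega
      have h6 : ¬ (n + 1 ≤ n) := by omega
      simp only [h4, h5, if_false] at hzj
      by_cases hin : i < n
      · simp only [hin, if_true] at hzi
        rcases h.meet i n z hin le_rfl hzi (hGP hzj) with h3 | h3
        · exfalso
          have := hEG z (h3.2 ▸ hs) hzj
          exact hx n le_rfl (h3.2 ▸ this)
        · right
          simpa using ⟨h3.1, h3.2.2⟩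
      · have hin' : i = n := by omega
        subst hin'
        simp only [lt_irrefl, if_false, if_true] at hzi
        left
        simp only [h6, if_false, true_and]
        exact hEG z hzi hzj
  · intro z
    obtain ⟨i, hin, hz⟩ := h.cover z
    by_cases h3 : i < n
    · exact ⟨i, by omega, by simpa [h3] using hz⟩
    · have : i = n := by omega
      subst this
      rw [← hu] at hz
      rcases hz with hz | hz
      · exact ⟨i, by omega, by simpa using hz⟩
      · exact ⟨i + 1, by omega, by simpa using hz⟩

lemma NatDec.delete [T2Space X] {n : ℕ} {x : ℕ → X} {P : ℕ → Set X} (h : NatDec (n + 1) x P)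
    (h2 : 2 ≤ n) :
    NatDec n x (fun i => if i < n then P i else P n ∪ P (n + 1)) := by
  constructor
  · exact h2
  · exact fun i j hi hj => h.inj i j (by omega) (by omega)
  · intro i hi
    split_ifs
    exacts [h.compact i (by omega), (h.compact n (by omega)).union (h.compact (n + 1) le_rfl)]
  · intro i hi
    split_ifs
    exacts [h.conn i (by omega), (h.conn n (by omega)).union
      ⟨x (n + 1), h.right n (by omega), h.left (n + 1) le_rfl⟩ (h.conn (n + 1) le_rfl)]
  · intro i hi
    split_ifs with h3
    · exact h.left i (by omega)
    · have : i = n := by omega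
      exact Or.inl (this ▸ h.left i (by omega))
  · intro i hi
    simp only [hi, if_true]
    exact h.right i (by omega)
  · simp only [lt_irrefl, if_false]
    exact Or.inr h.last
  · intro i j z hij hj hzi hzj
    have hin : i < n := by omega
    simp only [hin, if_true] at hzi
    by_cases hjn : j < n
    · simp only [hjn, if_true] at hzj
      rcases h.meet i j z hij (by omega) hzi hzj with h3 | h3
      · exact Or.inl h3
      · omega
    · have : j = n := by omega
      subst this
      simp only [lt_irrefl, if_false] at hzj
      rcases hzj with hzj | hzj
      · rcases h.meet i j z hij (by omega) hzi hzj with h3 | h3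
        · exact Or.inl h3
        · omega
      · rcases h.meet i (j + 1) z (by omega) (by omega) hzi hzj with h3 | h3
        · omega
        · exact Or.inr ⟨h3.1, rfl, h3.2.2⟩
  · intro z
    obtain ⟨i, hin, hz⟩ := h.cover z
    by_cases h3 : i < n
    · exact ⟨i, by omega, by simpa [h3] using hz⟩
    · refine ⟨n, le_rfl, ?_⟩
      simp only [lt_irrefl, if_false]
      rcases (by omega : i = n ∨ i = n + 1) with rfl | rfl
      exacts [Or.inl hz, Or.inr hz]

lemma DecSet.finite {A : Set X} (h : DecSet A) : A.Finite := by
  obtain ⟨n, x, P, -, rfl⟩ := h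
  exact (finite_Iic n).image x

lemma DecSet.diff_singleton [T2Space X] {A : Set X} (h : DecSet A) {r : X} (hr : r ∈ A)
    (hA : 4 ≤ A.ncard) : DecSet (A \ {r}) := by
  obtain ⟨n, x, P, h, rfl⟩ := h
  obtain ⟨i, hi, rfl⟩ := hr
  obtain ⟨x', P', h', hx, hxi⟩ := h.rotate hi
  rw [h.ncard_eq] at hA
  rw [hx, ← hxi]
  obtain ⟨n, rfl⟩ : ∃ m, n = m + 1 := ⟨n - 1, by omega⟩
  refine ⟨n, x', _, h'.delete (by omega), ?_⟩
  ext z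
  constructor
  · rintro ⟨⟨k, hk, rfl⟩, hne⟩
    refine ⟨k, ?_, rfl⟩
    have : k ≠ n + 1 := fun e => hne (by rw [e]; rfl)
    rw [mem_Iic] at hk ⊢
    omega
  · rintro ⟨k, hk, rfl⟩
    rw [mem_Iic] at hk
    refine ⟨⟨k, by rw [mem_Iic]; omega, rfl⟩, fun e => ?_⟩
    have := h'.inj _ _ (by omega) le_rfl e
    omega

lemma DecSet.mono [T2Space X] {A B : Set X} (h : DecSet A) (hBA : B ⊆ A) (hB : 3 ≤ B.ncard) :
    DecSet B := by
  induction hk : (A \ B).ncard generalizing A with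
  | zero =>
    have : A \ B = ∅ := (ncard_eq_zero (h.finite.subset sdiff_subset)).1 hk
    rwa [← hBA.antisymm (sdiff_eq_empty.1 this)] at h
  | succ k ih =>
    have hfin := h.finite
    obtain ⟨r, hrA, hrB⟩ : (A \ B).Nonempty :=
      nonempty_of_ncard_ne_zero (by omega)
    have hBr : B ⊆ A \ {r} := fun z hz => ⟨hBA hz, fun e => hrB (by rwa [← mem_singleton_iff.1 e])⟩
    have h1 := ncard_sdiff_singleton_add_one hrA hfin
    have h2 := ncard_le_ncard hBr (hfin.subset sdiff_subset)
    refine ih (h.diff_singleton hrA (by omega)) hBr ?_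
    have h3 : (A \ {r}) \ B = (A \ B) \ {r} := by
      ext z
      simp only [mem_sdiff]
      tauto
    have h4 := ncard_sdiff_singleton_add_one (s := A \ B) ⟨hrA, hrB⟩ (hfin.subset sdiff_subset)
    rw [h3]
    omega

/-- Two points of a decomposition cut the space into two arcs. -/
lemma DecSet.exists_arcs [T2Space X] {A : Set X} (h : DecSet A) {p q : X} (hp : p ∈ A)
    (hq : q ∈ A) (hpq : p ≠ q) :
    ∃ C₁ C₂ : Set X, IsClosed C₁ ∧ IsClosed C₂ ∧ C₁ ∪ C₂ = univ ∧ C₁ ∩ C₂ = {p, q} ∧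
      (C₁ \ {p, q}).Nonempty ∧ (C₂ \ {p, q}).Nonempty := by
  obtain ⟨n, x, P, h, rfl⟩ := h
  obtain ⟨i, hi, rfl⟩ := hq
  obtain ⟨x', P', h', hx, hxi⟩ := h.rotate hi
  rw [hx] at hp
  obtain ⟨k, hk, rfl⟩ := hp
  rw [← hxi] at hpq ⊢
  clear hx hxi h hi
  rw [mem_Iic] at hk
  have hkn : k < n := lt_of_le_of_ne hk (fun e => hpq (by rw [e]))
  have hn := h'.two_le
  have hne : ∀ i ≤ n, (P' i \ {x' k, x' n}).Nonempty := by
    intro i hi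
    by_contra hem
    rw [not_nonempty_iff_eq_empty, sdiff_eq_empty] at hem
    have hnt : (P' i).Nontrivial := by
      by_cases h3 : i < n
      · exact ⟨_, h'.left i hi, _, h'.right i h3, fun e => by
          have := h'.inj _ _ (by omega) (by omega) e
          omega⟩
      · have : i = n := by omega
        subst this
        exact ⟨_, h'.left i hi, _, h'.last, fun e => by
          have := h'.inj _ _ (by omega) (by omega) e
          omega⟩
    exact (h'.conn i hi).isPreconnected.infinite_of_nontrivial hnt
      ((toFinite {x' k, x' n}).subset hem)
  refine ⟨⋃ i ∈ Ico k n, P' i, ⋃ i ∈ Iic n \ Ico k n, P' i, ?_, ?_, ?_, ?_, ?_, ?_⟩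
  · exact (finite_Ico k n).isClosed_biUnion fun i hi => (h'.compact i hi.2.le).isClosed
  · exact ((finite_Iic n).subset sdiff_subset).isClosed_biUnion
      fun i hi => (h'.compact i hi.1).isClosed
  · rw [eq_univ_iff_forall]
    intro z
    obtain ⟨i, hi, hz⟩ := h'.cover z
    by_cases h3 : i ∈ Ico k n
    · exact Or.inl (mem_biUnion h3 hz)
    · exact Or.inr (mem_biUnion (show i ∈ Iic n \ Ico k n from ⟨hi, h3⟩) hz)
  · ext z
    simp only [mem_inter_iff, mem_iUnion, exists_prop, mem_sdiff, mem_Ico, mem_Iic,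
      mem_insert_iff, mem_singleton_iff]
    constructor
    · rintro ⟨⟨i, ⟨hi1, hi2⟩, hz1⟩, j, ⟨hj1, hj2⟩, hz2⟩
      rcases lt_trichotomy i j with hij | hij | hij
      · rcases h'.meet i j z hij hj1 hz1 hz2 with h3 | h3
        · right
          rw [h3.2]
          congr 1
          omega
        · left
          rw [h3.2.2]
          congr 1
          omega
      · omega
      · rcases h'.meet j i z hij hi2.le hz2 hz1 with h3 | h3
        · left
          rw [h3.2]
          congr 1
          omega
        · omega
    · rintro (rfl | rfl)
      · refine ⟨⟨k, ⟨le_rfl, hkn⟩, h'.left k hk⟩, ?_⟩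
        by_cases hk0 : k = 0
        · subst hk0
          exact ⟨n, ⟨le_rfl, by omega⟩, h'.last⟩
        · refine ⟨k - 1, ⟨by omega, by omega⟩, ?_⟩
          have := h'.right (k - 1) (by omega)
          rwa [Nat.sub_add_cancel (by omega)] at this
      · refine ⟨⟨n - 1, ⟨by omega, by omega⟩, ?_⟩, n, ⟨le_rfl, by omega⟩, h'.left n le_rfl⟩
        have := h'.right (n - 1) (by omega)
        rwa [Nat.sub_add_cancel (by omega)] at this
  · obtain ⟨z, hz, hz'⟩ := hne k hk
    exact ⟨z, mem_biUnion (show k ∈ Ico k n from ⟨le_rfl, hkn⟩) hz, hz'⟩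
  · obtain ⟨z, hz, hz'⟩ := hne n le_rfl
    exact ⟨z, mem_biUnion (show n ∈ Iic n \ Ico k n from ⟨mem_Iic.2 le_rfl, by simp⟩) hz, hz'⟩

/-- A piece together with a further division point splits the space into three arcs. -/
lemma Piece.exists_arcs [T2Space X] {A P : Set X} {s t r : X} (h : Piece A s t P) (hr : r ∈ A)
    (hrs : r ≠ s) (hrt : r ≠ t) :
    ∃ C₁ C₂ : Set X, IsClosed C₁ ∧ IsClosed C₂ ∧ P ∪ C₁ ∪ C₂ = univ ∧ C₁ ∩ C₂ = {r} ∧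
      P ∩ C₁ = {t} ∧ P ∩ C₂ = {s} := by
  obtain ⟨n, x, M, h, rfl, rfl, rfl, rfl⟩ := h
  obtain ⟨k, hk, rfl⟩ := hr
  rw [mem_Iic] at hk
  have hkn : k < n := lt_of_le_of_ne hk (fun e => hrs (by rw [e]))
  have hk0 : 0 < k := Nat.pos_of_ne_zero (fun e => hrt (by rw [e]))
  refine ⟨⋃ i ∈ Iio k, M i, ⋃ i ∈ Ico k n, M i, ?_, ?_, ?_, ?_, ?_, ?_⟩
  · exact (finite_Iio k).isClosed_biUnion
      fun i hi => (h.compact i ((mem_Iio.1 hi).le.trans hk)).isClosed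
  · exact (finite_Ico k n).isClosed_biUnion fun i hi => (h.compact i hi.2.le).isClosed
  · rw [eq_univ_iff_forall]
    intro z
    obtain ⟨i, hi, hz⟩ := h.cover z
    rcases (by omega : i < k ∨ (k ≤ i ∧ i < n) ∨ i = n) with h3 | h3 | rfl
    · exact Or.inl (Or.inr (mem_biUnion (show i ∈ Iio k from h3) hz))
    · exact Or.inr (mem_biUnion (show i ∈ Ico k n from h3) hz)
    · exact Or.inl (Or.inl hz)
  · ext z
    simp only [mem_inter_iff, mem_iUnion, exists_prop, mem_Ico, mem_Iio, mem_singleton_iff]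
    constructor
    · rintro ⟨⟨i, hi, hz1⟩, j, ⟨hj1, hj2⟩, hz2⟩
      rcases h.meet i j z (by omega) hj2.le hz1 hz2 with h3 | h3
      · rw [h3.2]
        congr 1
        omega
      · omega
    · rintro rfl
      refine ⟨⟨k - 1, by omega, ?_⟩, k, ⟨le_rfl, hkn⟩, h.left k hk⟩
      have := h.right (k - 1) (by omega)
      rwa [Nat.sub_add_cancel (by omega)] at this
  · ext z
    simp only [mem_inter_iff, mem_iUnion, exists_prop, mem_Iio, mem_singleton_iff]
    constructor
    · rintro ⟨hz1, i, hi, hz2⟩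
      rcases h.meet i n z (by omega) le_rfl hz2 hz1 with h3 | h3
      · omega
      · exact h3.2.2
    · rintro rfl
      exact ⟨h.last, 0, hk0, h.left 0 (by omega)⟩
  · ext z
    simp only [mem_inter_iff, mem_iUnion, exists_prop, mem_Ico, mem_singleton_iff]
    constructor
    · rintro ⟨hz1, i, hi, hz2⟩
      rcases h.meet i n z (by omega) le_rfl hz2 hz1 with h3 | h3
      · exact h3.2
      · omega
    · rintro rfl
      refine ⟨h.left n le_rfl, n - 1, ⟨by omega, by omega⟩, ?_⟩
      have := h.right (n - 1) (by omega)
      rwa [Nat.sub_add_cancel (by omega)] at this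

lemma Piece.decSet_insert_of_union {A P E G : Set X} {s t c : X} (h : Piece A s t P) (hc : c ∉ A)
    (hE : IsCompact E) (hG : IsCompact G) (hEc : IsConnected E) (hGc : IsConnected G)
    (hu : E ∪ G = P) (hi : E ∩ G = {c}) (hs : s ∈ E) (ht : t ∈ G) : DecSet (insert c A) := by
  obtain ⟨n, x, M, h, rfl, rfl, rfl, rfl⟩ := h
  refine ⟨n + 1, _, _, h.insert hc hE hG hEc hGc hu hi hs ht, ?_⟩
  ext z
  simp only [mem_insert_iff, mem_image, mem_Iic]
  constructor
  · rintro (rfl | ⟨k, hk, rfl⟩)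
    · exact ⟨n + 1, le_rfl, by simp⟩
    · exact ⟨k, by omega, by simp [hk]⟩
  · rintro ⟨k, hk, rfl⟩
    split_ifs with h3
    · exact Or.inr ⟨k, h3, rfl⟩
    · exact Or.inl rfl

lemma DecSet.cyclicFinset {A : Set X} (h : DecSet A) : CyclicFinset A := by
  obtain ⟨n, x, P, h, rfl⟩ := h
  exact Or.inr ⟨n + 1, _, _, h.cyclicDecomp, (range_val_eq_image_Iic x).symm⟩

lemma CyclicFinset.decSet {A : Set X} (h : CyclicFinset A) (hA : 3 ≤ A.ncard) : DecSet A := by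
  rcases h with ⟨a, b, -, rfl⟩ | ⟨n, x, M, h, rfl⟩
  · have := ncard_insert_le a {b}
    rw [ncard_singleton] at this
    omega
  · obtain ⟨n, rfl⟩ : ∃ m, n = m + 1 := ⟨n - 1, by have := h.1; omega⟩
    exact ⟨n, _, _, h.natDec 0, range_eq_image_Iic x 0⟩

lemma Piece.decSet {A P : Set X} {s t : X} (h : Piece A s t P) : DecSet A := by
  obtain ⟨n, x, M, h, rfl, -⟩ := h
  exact ⟨n, x, M, h, rfl⟩

lemma Piece.isCompact {A P : Set X} {s t : X} (h : Piece A s t P) : IsCompact P := by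
  obtain ⟨n, x, M, h, rfl, rfl, rfl, rfl⟩ := h
  exact h.compact n le_rfl

lemma Piece.isPreconnected {A P : Set X} {s t : X} (h : Piece A s t P) : IsPreconnected P := by
  obtain ⟨n, x, M, h, rfl, rfl, rfl, rfl⟩ := h
  exact (h.conn n le_rfl).isPreconnected

lemma Piece.left_mem {A P : Set X} {s t : X} (h : Piece A s t P) : s ∈ A ∧ s ∈ P := by
  obtain ⟨n, x, M, h, rfl, rfl, rfl, rfl⟩ := h
  exact ⟨⟨n, mem_Iic.2 le_rfl, rfl⟩, h.left n le_rfl⟩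

lemma Piece.right_mem {A P : Set X} {s t : X} (h : Piece A s t P) : t ∈ A ∧ t ∈ P := by
  obtain ⟨n, x, M, h, rfl, rfl, rfl, rfl⟩ := h
  exact ⟨⟨0, mem_Iic.2 (Nat.zero_le n), rfl⟩, h.last⟩

lemma Piece.ne {A P : Set X} {s t : X} (h : Piece A s t P) : s ≠ t := by
  obtain ⟨n, x, M, h, rfl, rfl, rfl, rfl⟩ := h
  intro e
  have := h.inj _ _ le_rfl (Nat.zero_le n) e
  have := h.two_le
  omega

lemma Piece.exists_third {A P : Set X} {s t : X} (h : Piece A s t P) :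
    ∃ r ∈ A, r ≠ s ∧ r ≠ t := by
  obtain ⟨n, x, M, h, rfl, rfl, rfl, rfl⟩ := h
  have h2 := h.two_le
  refine ⟨x 1, ⟨1, mem_Iic.2 (by omega), rfl⟩, fun e => ?_, fun e => ?_⟩
  · have := h.inj _ _ (by omega) le_rfl e
    omega
  · have := h.inj _ _ (by omega) (Nat.zero_le n) e
    omega

lemma DecSet.exists_piece {A : Set X} (h : DecSet A) (y : X) : ∃ s t P, Piece A s t P ∧ y ∈ P := by
  obtain ⟨n, x, P, h, rfl⟩ := h
  obtain ⟨i, hi, hy⟩ := h.cover y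
  obtain ⟨t, ht⟩ := h.piece hi
  exact ⟨_, t, _, ht, hy⟩

lemma Piece.eq_or_eq [T2Space X] {A P : Set X} {s t z : X} (h : Piece A s t P) (hz : z ∈ A)
    (hzP : z ∈ P) : z = s ∨ z = t := by
  by_contra! hne
  obtain ⟨C₁, C₂, -, -, -, h12, h1, -⟩ := h.exists_arcs hz hne.1 hne.2
  have hz1 : z ∈ C₁ ∩ C₂ := by rw [h12]; rfl
  have : z ∈ P ∩ C₁ := ⟨hzP, hz1.1⟩
  rw [h1] at this
  exact hne.2 this

lemma Piece.isOpen_diff [T2Space X] {A P : Set X} {s t : X} (h : Piece A s t P) :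
    IsOpen (P \ {s, t}) := by
  obtain ⟨r, hr, hrs, hrt⟩ := h.exists_third
  obtain ⟨C₁, C₂, hc1, hc2, hu, -, h1, h2⟩ := h.exists_arcs hr hrs hrt
  have : P \ {s, t} = (C₁ ∪ C₂)ᶜ := by
    ext z
    have e1 : z ∈ P ∩ C₁ ↔ z = t := by rw [h1]; rfl
    have e2 : z ∈ P ∩ C₂ ↔ z = s := by rw [h2]; rfl
    have e3 : z ∈ P ∪ C₁ ∪ C₂ := by rw [hu]; trivial
    simp only [mem_sdiff, mem_insert_iff, mem_singleton_iff, mem_compl_iff, mem_union,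
      mem_inter_iff] at *
    tauto
  rw [this]
  exact (hc1.union hc2).isOpen_compl

/-- The two arcs complementary to a piece stay connected after removing the common point `r`
or the point shared with the piece. -/
lemma Piece.exists_connected_arcs [T2Space X] (hnc : ∀ p : X, ¬CutPoint p) {A P : Set X}
    {s t r : X} (h : Piece A s t P) (hr : r ∈ A) (hrs : r ≠ s) (hrt : r ≠ t) :
    ∃ C₁ C₂ : Set X, IsClosed C₁ ∧ IsClosed C₂ ∧ P ∪ C₁ ∪ C₂ = univ ∧ C₁ ∩ C₂ = {r} ∧
      P ∩ C₁ = {t} ∧ P ∩ C₂ = {s} ∧ IsPreconnected (C₁ \ {r}) ∧ IsPreconnected (C₂ \ {r}) ∧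
      IsPreconnected (C₁ \ {t}) ∧ IsPreconnected (C₂ \ {s}) := by
  have hP := h.isCompact.isClosed
  obtain ⟨C₁, C₂, hc1, hc2, hu, h12, h1, h2⟩ := h.exists_arcs hr hrs hrt
  have e3 : ∀ z, z ∈ P ∪ C₁ ∪ C₂ := fun z => by rw [hu]; trivial
  have e1 : ∀ z, z ∈ P ∩ C₁ ↔ z = t := fun z => by rw [h1]; rfl
  have e2 : ∀ z, z ∈ P ∩ C₂ ↔ z = s := fun z => by rw [h2]; rfl
  have e4 : ∀ z, z ∈ C₁ ∩ C₂ ↔ z = r := fun z => by rw [h12]; rfl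
  have o1 : IsOpen (C₁ \ {r, t}) := by
    have : C₁ \ {r, t} = (P ∪ C₂)ᶜ := by
      ext z
      have := e1 z
      have := e2 z
      have := e3 z
      have := e4 z
      simp only [mem_sdiff, mem_insert_iff, mem_singleton_iff, mem_compl_iff, mem_union,
        mem_inter_iff] at *
      tauto
    rw [this]
    exact (hP.union hc2).isOpen_compl
  have o2 : IsOpen (C₂ \ {r, s}) := by
    have : C₂ \ {r, s} = (P ∪ C₁)ᶜ := by
      ext z
      have := e1 z
      have := e2 z
      have := e3 z
      have := e4 z
      simp only [mem_sdiff, mem_insert_iff, mem_singleton_iff, mem_compl_iff, mem_union,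
        mem_inter_iff] at *
      tauto
    rw [this]
    exact (hP.union hc1).isOpen_compl
  have hr' := (e4 r).2 rfl
  exact ⟨C₁, C₂, hc1, hc2, hu, h12, h1, h2,
    isPreconnected_diff_end hnc hc1 o1 ((e1 t).2 rfl).2 hrt,
    isPreconnected_diff_end hnc hc2 o2 ((e2 s).2 rfl).2 hrs,
    isPreconnected_diff_end hnc hc1 (by rwa [pair_comm]) hr'.1 hrt.symm,
    isPreconnected_diff_end hnc hc2 (by rwa [pair_comm]) hr'.2 hrs.symm⟩

lemma Piece.isPreconnected_compl [T2Space X] (hnc : ∀ p : X, ¬CutPoint p) {A P : Set X}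
    {s t : X} (h : Piece A s t P) : IsPreconnected Pᶜ := by
  obtain ⟨r, hr, hrs, hrt⟩ := h.exists_third
  obtain ⟨C₁, C₂, hc1, hc2, hu, h12, h1, h2, -, -, p1, p2⟩ :=
    h.exists_connected_arcs hnc hr hrs hrt
  have hrm : r ∈ C₁ ∩ C₂ := by rw [h12]; rfl
  have : Pᶜ = C₁ \ {t} ∪ C₂ \ {s} := by
    ext z
    have e1 : z ∈ P ∩ C₁ ↔ z = t := by rw [h1]; rfl
    have e2 : z ∈ P ∩ C₂ ↔ z = s := by rw [h2]; rfl
    have e3 : z ∈ P ∪ C₁ ∪ C₂ := by rw [hu]; trivial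
    simp only [mem_sdiff, mem_singleton_iff, mem_compl_iff, mem_union, mem_inter_iff] at *
    tauto
  rw [this]
  exact p1.union r ⟨hrm.1, hrt⟩ ⟨hrm.2, hrs⟩ p2

lemma Piece.isPreconnected_diff_left [T2Space X] (hnc : ∀ p : X, ¬CutPoint p) {A P : Set X}
    {s t : X} (h : Piece A s t P) : IsPreconnected (P \ {s}) :=
  isPreconnected_diff_end hnc h.isCompact.isClosed h.isOpen_diff h.right_mem.2 h.ne

lemma Piece.isPreconnected_diff_right [T2Space X] (hnc : ∀ p : X, ¬CutPoint p) {A P : Set X}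
    {s t : X} (h : Piece A s t P) : IsPreconnected (P \ {t}) :=
  isPreconnected_diff_end hnc h.isCompact.isClosed (pair_comm s t ▸ h.isOpen_diff)
    h.left_mem.2 h.ne.symm

/-- A connected set meeting a closed set `P` but avoiding a part `F` of `P` that contains the
frontier of `P` is contained in `P`. -/
lemma IsPreconnected.subset_of_isClosed {C P F : Set X} (hC : IsPreconnected C) (hP : IsClosed P)
    (hO : IsOpen (P \ F)) (hF : ∀ z ∈ C, z ∉ P ∩ F) {z : X} (hz : z ∈ C) (hzP : z ∈ P) :
    C ⊆ P := by
  by_contra hsub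
  obtain ⟨w, hw, hwP⟩ := not_subset.1 hsub
  obtain ⟨v, hv, hv1, hv2⟩ := hC (P \ F) Pᶜ hO hP.isOpen_compl
    (fun v hv => by
      by_cases h : v ∈ P
      · exact Or.inl ⟨h, fun hvF => hF v hv ⟨h, hvF⟩⟩
      · exact Or.inr h)
    ⟨z, hz, hzP, fun h => hF z hz ⟨hzP, h⟩⟩ ⟨w, hw, hwP⟩
  exact hv2 hv1.1

/-- Pieces of a finer decomposition are contained in pieces of a coarser one. -/
lemma Piece.subset_of_mem [T2Space X] (hnc : ∀ p : X, ¬CutPoint p) {A B P P' : Set X}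
    {s t s' t' z : X} (h : Piece A s t P) (h' : Piece B s' t' P') (hAB : A ⊆ B)
    (hz : z ∉ B) (hzP : z ∈ P) (hzP' : z ∈ P') : P' ⊆ P := by
  have hP := h.isCompact.isClosed
  have hends : ∀ w ∈ P', w ∈ P ∩ {s, t} → w = s' ∨ w = t' := by
    rintro w hw ⟨-, rfl | rfl⟩
    · exact h'.eq_or_eq (hAB h.left_mem.1) hw
    · exact h'.eq_or_eq (hAB h.right_mem.1) hw
  have hzs : z ≠ s' := fun e => hz (e ▸ h'.left_mem.1)
  have hzt : z ≠ t' := fun e => hz (e ▸ h'.right_mem.1)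
  have hs' : s' ∈ P := by
    by_contra hs'
    refine hs' ((h'.isPreconnected_diff_right hnc).subset_of_isClosed hP h.isOpen_diff ?_
      ⟨hzP', hzt⟩ hzP ⟨h'.left_mem.2, h'.ne⟩)
    rintro w ⟨hw1, hw2⟩ hw3
    rcases hends w hw1 hw3 with rfl | rfl
    exacts [hs' hw3.1, hw2 rfl]
  have ht' : t' ∈ P := by
    by_contra ht'
    refine ht' ((h'.isPreconnected_diff_left hnc).subset_of_isClosed hP h.isOpen_diff ?_
      ⟨hzP', hzs⟩ hzP ⟨h'.right_mem.2, h'.ne.symm⟩)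
    rintro w ⟨hw1, hw2⟩ hw3
    rcases hends w hw1 hw3 with rfl | rfl
    exacts [hw2 rfl, ht' hw3.1]
  intro w hw
  by_contra hwP
  have hsub : Pᶜ ⊆ P' := (h.isPreconnected_compl hnc).subset_of_isClosed
    h'.isCompact.isClosed h'.isOpen_diff (fun v hv hv' => by
      rcases hv'.2 with rfl | rfl
      exacts [hv hs', hv ht']) hwP hw
  obtain ⟨r, hr, hrs, hrt⟩ := h.exists_third
  have hrP : r ∉ P := fun hrP => (h.eq_or_eq hr hrP).elim hrs hrt
  rcases h'.eq_or_eq (hAB hr) (hsub hrP) with rfl | rfl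
  exacts [hrP hs', hrP ht']

lemma SepPair.isOpen {C U V : Set X} (hC : IsClosed C) (h : SepPair C U V) :
    IsOpen U ∧ IsOpen V := by
  obtain ⟨⟨O, hO, rfl⟩, ⟨O', hO', rfl⟩, -⟩ := h
  exact ⟨hO.inter hC.isOpen_compl, hO'.inter hC.isOpen_compl⟩

lemma cuts_of_arcs {C₁ C₂ T : Set X} (h1 : IsClosed C₁) (h2 : IsClosed C₂)
    (hu : C₁ ∪ C₂ = univ) (hi : C₁ ∩ C₂ = T) (hn1 : (C₁ \ T).Nonempty)
    (hn2 : (C₂ \ T).Nonempty) : Cuts T := by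
  subst hi
  have e3 : ∀ z, z ∈ C₁ ∪ C₂ := fun z => by rw [hu]; trivial
  refine ⟨C₂ᶜ, C₁ᶜ, ⟨C₂ᶜ, h2.isOpen_compl, ?_⟩, ⟨C₁ᶜ, h1.isOpen_compl, ?_⟩, ?_, ?_, ?_, ?_⟩
  · ext z
    simp only [mem_compl_iff, mem_inter_iff]
    tauto
  · ext z
    simp only [mem_compl_iff, mem_inter_iff]
    tauto
  · rw [Set.disjoint_left]
    intro z hz hz'
    exact (e3 z).elim hz' hz
  · ext z
    simp only [mem_compl_iff, mem_inter_iff, mem_union]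
    tauto
  · obtain ⟨z, hz, hz'⟩ := hn1
    exact ⟨z, fun h => hz' ⟨hz, h⟩⟩
  · obtain ⟨z, hz, hz'⟩ := hn2
    exact ⟨z, fun h => hz' ⟨h, hz⟩⟩

lemma DecSet.cyclicFinset_of_subset [T2Space X] (hnc : ∀ p : X, ¬CutPoint p) {B : Set X}
    (h : DecSet B) (A : Finset X) (hAB : ↑A ⊆ B) (hA : 1 < A.card) :
    CyclicFinset (↑A : Set X) := by
  classical
  rcases (by omega : A.card = 2 ∨ 3 ≤ A.card) with h2 | h3
  · obtain ⟨p, q, hpq, rfl⟩ := Finset.card_eq_two.1 h2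
    obtain ⟨C₁, C₂, h1, h2, hu, hi, hn1, hn2⟩ :=
      h.exists_arcs (hAB (by simp)) (hAB (by simp)) hpq
    exact Or.inl ⟨p, q, ⟨hpq, hnc p, hnc q, cuts_of_arcs h1 h2 hu hi hn1 hn2⟩, by simp⟩
  · exact (h.mono hAB (by rwa [ncard_coe_finset])).cyclicFinset

section Split

variable [T1Space X] {P U V : Set X} {s t c d : X}

lemma mem_closure_inter_of_separation (hnc : ∀ p : X, ¬CutPoint p)
    (hN : IsOpen (P \ {s, t})) (hU : IsOpen U) (hV : IsOpen V) (hdis : ∀ z ∈ U, z ∉ V)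
    (hcov : ∀ z, z ≠ c → z ≠ d → z ∈ U ∨ z ∈ V) (hdU : d ∉ U) (hdV : d ∉ V)
    (hc : c ∈ P) (hcs : c ≠ s) (hct : c ≠ t) (hd : d ∉ P) (hUn : U.Nonempty) :
    c ∈ closure (P ∩ U) := by
  rw [mem_closure_iff]
  intro O hO hcO
  by_contra hem
  rw [not_nonempty_iff_eq_empty, eq_empty_iff_forall_notMem] at hem
  have hcN : c ∈ P \ {s, t} := ⟨hc, by simp [hcs, hct]⟩
  refine not_cutPoint_partition (hnc d) (U := U) (V := V ∪ (O ∩ (P \ {s, t}))) hU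
    (hV.union (hO.inter hN)) hdU ?_ ?_ ?_ hUn ⟨c, Or.inr ⟨hcO, hcN⟩⟩
  · rintro (h | h)
    exacts [hdV h, hd h.2.1]
  · rintro z hz (h | h)
    exacts [hdis z hz h, hem z ⟨h.1, h.2.1, hz⟩]
  · intro z hz
    by_cases hzc : z = c
    · exact Or.inr (Or.inr (hzc ▸ ⟨hcO, hcN⟩))
    · exact (hcov z hzc hz).imp id Or.inl

lemma end_mem_of_separation (hnc : ∀ p : X, ¬CutPoint p) (hP : IsClosed P)
    (hN : IsOpen (P \ {s, t})) (hU : IsOpen U) (hV : IsOpen V) (hdis : ∀ z ∈ U, z ∉ V)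
    (hcov : ∀ z, z ≠ c → z ≠ d → z ∈ U ∨ z ∈ V) (hcU : c ∉ U) (hdU : d ∉ U) (hdV : d ∉ V)
    (hc : c ∈ P) (hs : s ∈ P) (hcs : c ≠ s) (hct : c ≠ t) (hd : d ∉ P) (hUn : U.Nonempty) :
    s ∈ U ∨ t ∈ U := by
  by_contra! hst
  have hPU : (P ∩ U).Nonempty := closure_nonempty_iff.1
    ⟨c, mem_closure_inter_of_separation hnc hN hU hV hdis hcov hdU hdV hc hcs hct hd hUn⟩
  refine not_cutPoint_partition (hnc c) (U := (P \ {s, t}) ∩ U) (V := {c}ᶜ ∩ (Pᶜ ∪ V))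
    (hN.inter hU) (isOpen_compl_singleton.inter (hP.isOpen_compl.union hV))
    (fun h => hcU h.2) (fun h => h.1 rfl) ?_ ?_ ?_ ?_
  · rintro z ⟨⟨hz1, -⟩, hz2⟩ ⟨-, hz3 | hz3⟩
    exacts [hz3 hz1, hdis z hz2 hz3]
  · intro z hz
    by_cases hzP : z ∈ P
    · rcases hcov z hz (fun e => hd (e ▸ hzP)) with h | h
      · refine Or.inl ⟨⟨hzP, ?_⟩, h⟩
        rintro (rfl | rfl)
        exacts [hst.1 h, hst.2 h]
      · exact Or.inr ⟨hz, Or.inr h⟩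
    · exact Or.inr ⟨hz, Or.inl hzP⟩
  · obtain ⟨z, hz1, hz2⟩ := hPU
    refine ⟨z, ⟨hz1, ?_⟩, hz2⟩
    rintro (rfl | rfl)
    exacts [hst.1 hz2, hst.2 hz2]
  · exact ⟨s, hcs.symm, Or.inr ((hcov s hcs.symm (fun e => hd (e ▸ hs))).resolve_left hst.1)⟩

lemma isConnected_side_of_separation (hnc : ∀ p : X, ¬CutPoint p) (hP : IsClosed P)
    (hN : IsOpen (P \ {s, t})) (hU : IsOpen U) (hV : IsOpen V) (hdis : ∀ z ∈ U, z ∉ V)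
    (hcov : ∀ z, z ≠ c → z ≠ d → z ∈ U ∨ z ∈ V) (hcU : c ∉ U) (hdU : d ∉ U) (hdV : d ∉ V)
    (hc : c ∈ P) (hs : s ∈ P) (hcs : c ≠ s) (hct : c ≠ t) (hd : d ∉ P) (hUn : U.Nonempty)
    (hsU : s ∈ U) (htV : t ∈ V) : IsConnected (P ∩ Vᶜ) := by
  have hsV := hdis s hsU
  have hopen : IsOpen ((P ∩ Vᶜ) \ {c, s}) := by
    have : (P ∩ Vᶜ) \ {c, s} = (P \ {s, t}) ∩ (U ∩ {s}ᶜ) := by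
      ext z
      simp only [mem_sdiff, mem_inter_iff, mem_compl_iff, mem_insert_iff, mem_singleton_iff]
      constructor
      · rintro ⟨⟨hz1, hz2⟩, hz3⟩
        push Not at hz3
        refine ⟨⟨hz1, ?_⟩, (hcov z hz3.1 (fun e => hd (e ▸ hz1))).resolve_right hz2, hz3.2⟩
        rintro (rfl | rfl)
        exacts [hz3.2 rfl, hz2 htV]
      · rintro ⟨⟨hz1, -⟩, hz2, hz3⟩
        refine ⟨⟨hz1, hdis z hz2⟩, ?_⟩
        rintro (rfl | rfl)
        exacts [hcU hz2, hz3 rfl]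
    rw [this]
    exact hN.inter (hU.inter isOpen_compl_singleton)
  have hpre := isPreconnected_diff_end hnc (hP.inter hV.isClosed_compl) hopen ⟨hs, hsV⟩ hcs
  refine ⟨⟨s, hs, hsV⟩, hpre.subset_closure sdiff_subset ?_⟩
  intro z hz
  by_cases hzc : z = c
  · subst hzc
    refine closure_mono ?_ (mem_closure_inter_of_separation hnc hN hU hV hdis hcov hdU hdV hc
      hcs hct hd hUn)
    rintro w ⟨hw1, hw2⟩
    refine ⟨⟨hw1, hdis w hw2⟩, ?_⟩
    rintro rfl
    exact hcU hw2
  · exact subset_closure ⟨hz, hzc⟩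

end Split

/-- A piece with a point `c` forming a cut set with a point outside the piece splits at `c`. -/
lemma Piece.decSet_insert [T2Space X] (hnc : ∀ p : X, ¬CutPoint p) {A P : Set X} {s t c d : X}
    (h : Piece A s t P) (hc : c ∈ P) (hcA : c ∉ A) (hd : d ∉ P) (hcd : Cuts ({c, d} : Set X)) :
    DecSet (insert c A) := by
  obtain ⟨U, V, hUV⟩ := hcd
  obtain ⟨hU, hV⟩ := hUV.isOpen (toFinite _).isClosed
  obtain ⟨-, -, hdis, hun, hUn, hVn⟩ := hUV
  have hdis' : ∀ z ∈ U, z ∉ V := fun z h1 h2 => Set.disjoint_left.1 hdis h1 h2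
  have hmem : ∀ z, z ∈ U ∪ V ↔ z ∈ ({c, d} : Set X)ᶜ := fun z => by rw [hun]
  simp only [mem_union, mem_compl_iff, mem_insert_iff, mem_singleton_iff, not_or] at hmem
  have hcov : ∀ z, z ≠ c → z ≠ d → z ∈ U ∨ z ∈ V := fun z h1 h2 => (hmem z).2 ⟨h1, h2⟩
  have hcU : c ∉ U := fun h => ((hmem c).1 (Or.inl h)).1 rfl
  have hcV : c ∉ V := fun h => ((hmem c).1 (Or.inr h)).1 rfl
  have hdU : d ∉ U := fun h => ((hmem d).1 (Or.inl h)).2 rfl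
  have hdV : d ∉ V := fun h => ((hmem d).1 (Or.inr h)).2 rfl
  have hcov' : ∀ z, z ≠ c → z ≠ d → z ∈ V ∨ z ∈ U := fun z h1 h2 => (hcov z h1 h2).symm
  have hdis'' : ∀ z ∈ V, z ∉ U := fun z h1 h2 => hdis' z h2 h1
  have hP := h.isCompact.isClosed
  have hN := h.isOpen_diff
  have hN' : IsOpen (P \ {t, s}) := by rwa [pair_comm]
  have hs := h.left_mem.2
  have ht := h.right_mem.2
  have hcs : c ≠ s := fun e => hcA (e ▸ h.left_mem.1)
  have hct : c ≠ t := fun e => hcA (e ▸ h.right_mem.1)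
  have hVk : IsCompact (P ∩ Vᶜ) := h.isCompact.inter_right hV.isClosed_compl
  have hUk : IsCompact (P ∩ Uᶜ) := h.isCompact.inter_right hU.isClosed_compl
  have hu : P ∩ Vᶜ ∪ P ∩ Uᶜ = P := by
    ext z
    have := hdis' z
    simp only [mem_union, mem_inter_iff, mem_compl_iff]
    tauto
  have hi : P ∩ Vᶜ ∩ (P ∩ Uᶜ) = {c} := by
    ext z
    simp only [mem_inter_iff, mem_compl_iff, mem_singleton_iff]
    constructor
    · rintro ⟨⟨hz, hzV⟩, -, hzU⟩
      by_contra hzc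
      exact (hcov z hzc (fun e => hd (e ▸ hz))).elim hzU hzV
    · rintro rfl
      exact ⟨⟨hc, hcV⟩, hc, hcU⟩
  have m1 := end_mem_of_separation hnc hP hN hU hV hdis' hcov hcU hdU hdV hc hs hcs hct hd hUn
  have m2 := end_mem_of_separation hnc hP hN hV hU hdis'' hcov' hcV hdV hdU hc hs hcs hct hd hVn
  by_cases hsU : s ∈ U
  · have htV := m2.resolve_left (hdis' s hsU)
    exact h.decSet_insert_of_union hcA hVk hUk
      (isConnected_side_of_separation hnc hP hN hU hV hdis' hcov hcU hdU hdV hc hs hcs hct hd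
        hUn hsU htV)
      (isConnected_side_of_separation hnc hP hN' hV hU hdis'' hcov' hcV hdV hdU hc ht hct hcs hd
        hVn htV hsU) hu hi ⟨hs, hdis' s hsU⟩ ⟨ht, hdis'' t htV⟩
  · have htU := m1.resolve_left hsU
    have hsV := m2.resolve_right (hdis' t htU)
    exact h.decSet_insert_of_union hcA hUk hVk
      (isConnected_side_of_separation hnc hP hN hV hU hdis'' hcov' hcV hdV hdU hc hs hcs hct hd
        hVn hsV htU)
      (isConnected_side_of_separation hnc hP hN' hU hV hdis' hcov hcU hdU hdV hc ht hct hcs hd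
        hUn htU hsV) (by rwa [union_comm]) (by rwa [inter_comm])
      ⟨hs, hsU⟩ ⟨ht, hdis' t htU⟩

/-- The intersection of all pieces containing `y` of decompositions by finite subsets of `S`. -/
def gapHull (S : Set X) (y : X) : Set X :=
  {z | ∀ A s t P, A ⊆ S → Piece A s t P → y ∈ P → z ∈ P}

lemma mem_gapHull {S : Set X} {y : X} : y ∈ gapHull S y := fun _ _ _ _ _ _ h => h

lemma sEquiv_iff [T2Space X] {S : Set X} {y z : X} (hy : y ∉ S) :
    SEquiv S y z ↔ z ∈ gapHull S y ∧ z ∉ S := by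
  constructor
  · rintro ⟨-, hz, h⟩
    refine ⟨?_, hz⟩
    rintro A s t P hA hP hyP
    obtain ⟨n, x, M, hM, rfl, rfl, rfl, rfl⟩ := hP
    obtain ⟨i, hyi, hzi⟩ := h _ _ _ hM.cyclicDecomp (by rwa [range_val_eq_image_Iic])
    have hi : i.val ≤ n := Nat.lt_succ_iff.1 (ZMod.val_lt _)
    rcases hi.lt_or_eq with hi | hi
    · exfalso
      obtain ⟨k, hk, e⟩ : y ∈ x '' Iic n := by
        rcases hM.meet _ _ y hi le_rfl hyi hyP with ⟨-, e⟩ | ⟨-, -, e⟩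
        · exact ⟨n, mem_Iic.2 le_rfl, e.symm⟩
        · exact ⟨0, mem_Iic.2 (Nat.zero_le n), e.symm⟩
      exact hy (hA ⟨k, hk, e⟩)
    · rwa [← hi]
  · rintro ⟨h, hz⟩
    refine ⟨hy, hz, ?_⟩
    intro n x M hM hx
    obtain ⟨n, rfl⟩ : ∃ m, n = m + 1 := ⟨n - 1, by have := hM.1; omega⟩
    have : y ∈ ⋃ i, M i := by rw [hM.2.2.2.2.2]; trivial
    obtain ⟨i, hi⟩ := mem_iUnion.1 this
    exact ⟨i, hi, h _ _ _ _ hx (hM.piece i) hi⟩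

section Gap

variable [T2Space X] {S : Set X} {y : X}

lemma exists_piece_subset (hnc : ∀ p : X, ¬CutPoint p)
    (hD : ∀ A ⊆ S, A.Finite → ∃ B, A ⊆ B ∧ B ⊆ S ∧ DecSet B) (hy : y ∉ S) {A : Set X}
    (hA : A ⊆ S) (hf : A.Finite) :
    ∃ B s t P, A ⊆ B ∧ B ⊆ S ∧ Piece B s t P ∧ y ∈ P ∧
      ∀ A' s' t' P', A' ⊆ A → Piece A' s' t' P' → y ∈ P' → P ⊆ P' := by
  obtain ⟨B, hAB, hBS, hB⟩ := hD A hA hf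
  obtain ⟨s, t, P, hP, hyP⟩ := hB.exists_piece y
  exact ⟨B, s, t, P, hAB, hBS, hP, hyP, fun A' s' t' P' hA' hP' hyP' =>
    hP'.subset_of_mem hnc hP (hA'.trans hAB) (fun h => hy (hBS h)) hyP' hyP⟩

lemma exists_piece_avoiding (hnc : ∀ p : X, ¬CutPoint p)
    (hD : ∀ A ⊆ S, A.Finite → ∃ B, A ⊆ B ∧ B ⊆ S ∧ DecSet B) (hy : y ∉ S) {A : Set X}
    (hA : A ⊆ S) (hf : A.Finite) {z w : X} (hz : z ∉ gapHull S y) (hw : w ∉ gapHull S y) :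
    ∃ B s t P, A ⊆ B ∧ B ⊆ S ∧ Piece B s t P ∧ y ∈ P ∧ z ∉ P ∧ w ∉ P ∧
      ∀ A' s' t' P', A' ⊆ A → Piece A' s' t' P' → y ∈ P' → P ⊆ P' := by
  simp only [gapHull, mem_ofPred_eq, not_forall] at hz hw
  obtain ⟨A₁, s₁, t₁, P₁, hA₁, h₁, hy₁, hz⟩ := hz
  obtain ⟨A₂, s₂, t₂, P₂, hA₂, h₂, hy₂, hw⟩ := hw
  obtain ⟨B, s, t, P, hAB, hBS, hP, hyP, hmin⟩ := exists_piece_subset hnc hD hy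
    (union_subset hA (union_subset hA₁ hA₂))
    (hf.union (h₁.decSet.finite.union h₂.decSet.finite))
  refine ⟨B, s, t, P, subset_union_left.trans hAB, hBS, hP, hyP, fun h => hz ?_, fun h => hw ?_,
    fun A' s' t' P' hA' => hmin A' s' t' P' (hA'.trans subset_union_left)⟩
  · exact hmin A₁ s₁ t₁ P₁ (subset_union_left.trans subset_union_right) h₁ hy₁ h
  · exact hmin A₂ s₂ t₂ P₂ (subset_union_right.trans subset_union_right) h₂ hy₂ h

lemma cyclicSet_insert (hnc : ∀ p : X, ¬CutPoint p)
    (hD : ∀ A ⊆ S, A.Finite → ∃ B, A ⊆ B ∧ B ⊆ S ∧ DecSet B) (hy : y ∉ S)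
    {c d : X} (hc : c ∈ gapHull S y) (hcS : c ∉ S) (hd : d ∉ gapHull S y)
    (hcd : Cuts ({c, d} : Set X)) : CyclicSet (insert c S) := by
  intro A hA hcard
  have hsub : ∀ z ∈ A, z ≠ c → z ∈ S := fun z hz hne => (hA hz).resolve_left hne
  obtain ⟨B, s, t, P, hAB, hBS, hP, hyP, hdP, -, -⟩ := exists_piece_avoiding hnc hD hy
    (A := ↑A \ {c}) (fun z hz => hsub z hz.1 hz.2) (A.finite_toSet.subset sdiff_subset) hd hd
  have hB := hP.decSet_insert hnc (hc B s t P hBS hP hyP) (fun h => hcS (hBS h)) hdP hcd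
  refine hB.cyclicFinset_of_subset hnc A (fun z hz => ?_) hcard
  by_cases hzc : z = c
  · exact Or.inl hzc
  · exact Or.inr (hAB ⟨hz, hzc⟩)

/-- A connected set avoiding `r` and a piece containing `y`. -/
def GapArc (S : Set X) (y r : X) (C : Set X) : Prop :=
  IsPreconnected C ∧ r ∉ C ∧ ∃ B u v P, B ⊆ S ∧ Piece B u v P ∧ y ∈ P ∧ ∀ w ∈ C, w ∉ P

lemma GapArc.union (hnc : ∀ p : X, ¬CutPoint p)
    (hD : ∀ A ⊆ S, A.Finite → ∃ B, A ⊆ B ∧ B ⊆ S ∧ DecSet B) (hy : y ∉ S) {r w : X}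
    {C C' : Set X} (h : GapArc S y r C) (h' : GapArc S y r C') (hw : w ∈ C) (hw' : w ∈ C') :
    GapArc S y r (C ∪ C') := by
  obtain ⟨hC, hr, B, u, v, P, hB, hP, hyP, hCP⟩ := h
  obtain ⟨hC', hr', B', u', v', P', hB', hP', hyP', hCP'⟩ := h'
  obtain ⟨A, s, t, Q, -, hAS, hQ, hyQ, hmin⟩ := exists_piece_subset hnc hD hy
    (union_subset hB hB') (hP.decSet.finite.union hP'.decSet.finite)
  refine ⟨hC.union w hw hw' hC', fun h => h.elim hr hr', A, s, t, Q, hAS, hQ, hyQ, ?_⟩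
  rintro z (hz | hz) hzQ
  · exact hCP z hz (hmin _ _ _ _ subset_union_left hP hyP hzQ)
  · exact hCP' z hz (hmin _ _ _ _ subset_union_right hP' hyP' hzQ)

lemma exists_gapArc (hnc : ∀ p : X, ¬CutPoint p)
    (hD : ∀ A ⊆ S, A.Finite → ∃ B, A ⊆ B ∧ B ⊆ S ∧ DecSet B) (hy : y ∉ S)
    (hK : ∀ z ≠ y, z ∉ gapHull S y) {r z : X} (hr : r ∈ S) (hzy : z ≠ y) (hzr : z ≠ r) :
    ∃ O C, IsOpen O ∧ z ∈ O ∧ O ⊆ C ∧ GapArc S y r C := by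
  have hSy : ∀ w ∈ S, w ∉ gapHull S y := fun w hw => hK w (fun e => hy (e ▸ hw))
  obtain ⟨B, s, t, P, hrB, hBS, hP, hyP, hzP, hrP, -⟩ := exists_piece_avoiding hnc hD hy
    (singleton_subset_iff.2 hr) (finite_singleton r) (hK z hzy) (hSy r hr)
  obtain ⟨C₁, C₂, h1, h2, hu, h12, hP1, hP2, hc1, hc2, -⟩ :=
    hP.exists_connected_arcs hnc (hrB rfl) (fun e => hrP (e ▸ hP.left_mem.2))
      (fun e => hrP (e ▸ hP.right_mem.2))
  obtain ⟨B', s', t', P', -, hBS', hP', hyP', hsP', htP', hmin⟩ := exists_piece_avoiding hnc hD hy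
    hBS hP.decSet.finite (hSy s (hBS hP.left_mem.1)) (hSy t (hBS hP.right_mem.1))
  have hsub : P' ⊆ P := hmin B s t P Subset.rfl hP hyP
  have hcl := hP.isCompact.isClosed
  have key : ∀ C C' : Set X, ∀ e, IsClosed C' → P ∪ C ∪ C' = univ → C ∩ C' = {r} → P ∩ C = {e} →
      e ∉ P' → IsPreconnected (C \ {r}) → z ∉ C' →
      ∃ O C, IsOpen O ∧ z ∈ O ∧ O ⊆ C ∧ GapArc S y r C := by
    intro C C' e hC' hu hi hPC he hC hz
    refine ⟨(P ∪ C')ᶜ, C \ {r}, (hcl.union hC').isOpen_compl, fun h => h.elim hzP hz, ?_, hC,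
      fun h => h.2 rfl, B', s', t', P', hBS', hP', hyP', ?_⟩
    · intro w hw
      have hr' : r ∈ C ∩ C' := by rw [hi]; rfl
      have hw' : w ∈ P ∪ C ∪ C' := by rw [hu]; trivial
      refine ⟨?_, ?_⟩
      · rcases hw' with (h | h) | h
        exacts [(hw (Or.inl h)).elim, h, (hw (Or.inr h)).elim]
      · rintro rfl
        exact hw (Or.inr hr'.2)
    · rintro w ⟨hw, -⟩ hwP
      have : w ∈ P ∩ C := ⟨hsub hwP, hw⟩
      rw [hPC] at this
      exact he (this ▸ hwP)
  by_cases hz : z ∈ C₂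
  · refine key C₂ C₁ s h1 (by rwa [union_right_comm]) (by rwa [inter_comm]) hP2 hsP' hc2 ?_
    intro hz'
    have : z ∈ C₁ ∩ C₂ := ⟨hz', hz⟩
    rw [h12] at this
    exact hzr this
  · exact key C₁ C₂ t h2 hu h12 hP1 htP' hc1 hz

lemma GapArc.right_notMem (hnc : ∀ p : X, ¬CutPoint p)
    (hD : ∀ A ⊆ S, A.Finite → ∃ B, A ⊆ B ∧ B ⊆ S ∧ DecSet B) (hy : y ∉ S) {A C P : Set X}
    {r s t : X} (hA : A ⊆ S) (hP : Piece A s t P) (hyP : y ∈ P) (hr : r ∈ A) (hrs : r ≠ s)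
    (hrt : r ≠ t) (hC : GapArc S y r C) (hs : s ∈ C) : t ∉ C := by
  intro ht
  obtain ⟨hC, hrC, B, u, v, Q, hB, hQ, hyQ, hCQ⟩ := hC
  obtain ⟨B', d, t', P', hBB, -, hP', hyP', hmin⟩ := exists_piece_subset hnc hD hy
    (union_subset hA hB) (hP.decSet.finite.union hQ.decSet.finite)
  have hdP : d ∈ P := hmin _ _ _ _ subset_union_left hP hyP hP'.left_mem.2
  have hdQ : d ∈ Q := hmin _ _ _ _ subset_union_right hQ hyQ hP'.left_mem.2
  have hdC : d ∉ C := fun h => hCQ d h hdQ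
  have hrP : r ∉ P := fun h => (hP.eq_or_eq hr h).elim hrs hrt
  have hrd : r ≠ d := fun e => hrP (e ▸ hdP)
  obtain ⟨C₁, C₂, h1, h2, hu, hi, hn1, hn2⟩ :=
    hP'.decSet.exists_arcs (hBB (Or.inl hr)) hP'.left_mem.1 hrd
  have hopen : ∀ D E : Set X, IsClosed E → D ∪ E = univ → D ∩ E = {r, d} →
      IsOpen (D \ {r, d}) := by
    intro D E hE hu hi
    have : D \ {r, d} = Eᶜ := by
      ext z
      have : z ∈ D ∪ E := by rw [hu]; trivial
      simp only [← hi, mem_sdiff, mem_inter_iff, mem_compl_iff, mem_union] at this ⊢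
      tauto
    rw [this]
    exact hE.isOpen_compl
  have hend : ∀ D E : Set X, IsClosed D → IsClosed E → D ∪ E = univ → D ∩ E = {r, d} →
      (D \ {r, d}).Nonempty → s ∈ D ∨ t ∈ D := by
    intro D E hDc hE hu hi hn
    by_contra! hst
    have hO := hopen D E hE hu hi
    have hF : ∀ z ∈ D, z ∉ P ∩ {s, t} := by
      rintro z hz ⟨-, rfl | rfl⟩
      exacts [hst.1 hz, hst.2 hz]
    have hrd' : r ∈ D ∩ E ∧ d ∈ D ∩ E := by rw [hi]; simp
    have hc1 := isPreconnected_diff_end hnc hDc hO hrd'.2.1 hrd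
    have hc2 := isPreconnected_diff_end hnc hDc (pair_comm r d ▸ hO) hrd'.1.1 hrd.symm
    obtain ⟨z, hz, hz'⟩ := hn
    simp only [mem_insert_iff, mem_singleton_iff, not_or] at hz'
    have hzP : z ∈ P := hc1.subset_of_isClosed hP.isCompact.isClosed hP.isOpen_diff
      (fun w hw => hF w hw.1) (z := d) ⟨hrd'.2.1, hrd.symm⟩ hdP ⟨hz, hz'.1⟩
    exact hrP (hc2.subset_of_isClosed hP.isCompact.isClosed hP.isOpen_diff
      (fun w hw => hF w hw.1) (z := z) ⟨hz, hz'.2⟩ hzP ⟨hrd'.1.1, hrd⟩)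
  have hside : ∀ D E : Set X, IsClosed D → IsClosed E → D ∪ E = univ → D ∩ E = {r, d} →
      (E \ {r, d}).Nonempty → s ∉ D := by
    intro D E hDc hE hu hi hn hsD
    have hCD : C ⊆ D := by
      refine hC.subset_of_isClosed hDc (hopen D E hE hu hi) ?_ hs hsD
      rintro z hz ⟨-, rfl | rfl⟩
      exacts [hrC hz, hdC hz]
    have hnot : ∀ z ∈ C, z ∉ E := by
      intro z hz hzE
      have : z ∈ D ∩ E := ⟨hCD hz, hzE⟩
      rw [hi] at this
      rcases this with rfl | rfl
      exacts [hrC hz, hdC hz]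
    exact (hend E D hE hDc (by rwa [union_comm]) (by rwa [inter_comm]) hn).elim (hnot s hs)
      (hnot t ht)
  have hs12 : s ∈ C₁ ∪ C₂ := by rw [hu]; trivial
  exact hs12.elim (hside C₁ C₂ h1 h2 hu hi hn2)
    (hside C₂ C₁ h2 h1 (by rwa [union_comm]) (by rwa [inter_comm]) hn1)

lemma exists_cuts_of_gapHull (hnc : ∀ p : X, ¬CutPoint p)
    (hD : ∀ A ⊆ S, A.Finite → ∃ B, A ⊆ B ∧ B ⊆ S ∧ DecSet B) (hy : y ∉ S)
    (hK : ∀ z ≠ y, z ∉ gapHull S y) : ∃ r ∉ gapHull S y, Cuts ({y, r} : Set X) := by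
  obtain ⟨A, s, t, P, -, hAS, hP, hyP, -⟩ :=
    exists_piece_subset hnc hD hy (empty_subset S) finite_empty
  obtain ⟨r, hr, hrs, hrt⟩ := hP.exists_third
  have hSy : ∀ w ∈ S, w ≠ y := fun w hw e => hy (e ▸ hw)
  have hrS := hAS hr
  have hsS := hAS hP.left_mem.1
  have htS := hAS hP.right_mem.1
  have hne : ∀ C, GapArc S y r C → ∀ z ∈ C, z ≠ y ∧ z ≠ r := by
    rintro C ⟨-, hrC, B, u, v, Q, -, -, hyQ, hCQ⟩ z hz
    refine ⟨?_, ?_⟩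
    · rintro rfl
      exact hCQ z hz hyQ
    · rintro rfl
      exact hrC hz
  set U : Set X := {z | ∃ C, GapArc S y r C ∧ s ∈ C ∧ z ∈ C} with hUdef
  have hUne : ∀ z ∈ U, z ≠ y ∧ z ≠ r := by
    rintro z ⟨C, hC, -, hz⟩
    exact hne C hC z hz
  have hcomb : ∀ C, GapArc S y r C → ∀ w ∈ C, w ∈ U → C ⊆ U := by
    rintro C hC w hw ⟨C', hC', hs, hw'⟩ z hz
    exact ⟨C ∪ C', hC.union hnc hD hy hC' hw hw', Or.inr hs, Or.inl hz⟩
  have hUo : IsOpen U := by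
    rw [isOpen_iff_forall_mem_open]
    intro z hz
    obtain ⟨O, C, hO, hzO, hOC, hC⟩ :=
      exists_gapArc hnc hD hy hK hrS (hUne z hz).1 (hUne z hz).2
    exact ⟨O, hOC.trans (hcomb C hC z (hOC hzO) hz), hO, hzO⟩
  have hVo : IsOpen (({y, r} : Set X)ᶜ \ U) := by
    rw [isOpen_iff_forall_mem_open]
    rintro z ⟨hz, hzU⟩
    simp only [mem_compl_iff, mem_insert_iff, mem_singleton_iff, not_or] at hz
    obtain ⟨O, C, hO, hzO, hOC, hC⟩ := exists_gapArc hnc hD hy hK hrS hz.1 hz.2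
    refine ⟨O, fun w hw => ⟨?_, fun hwU => ?_⟩, hO, hzO⟩
    · have := hne C hC w (hOC hw)
      simp [this.1, this.2]
    · exact hzU (hcomb C hC w (hOC hw) hwU (hOC hzO))
  have hUsub : U ⊆ ({y, r} : Set X)ᶜ := fun z hz => by
    have := hUne z hz
    simp [this.1, this.2]
  refine ⟨r, hK r (hSy r hrS), U, ({y, r} : Set X)ᶜ \ U,
    ⟨U, hUo, (inter_eq_left.2 hUsub).symm⟩,
    ⟨_, hVo, (inter_eq_left.2 sdiff_subset).symm⟩, disjoint_sdiff_right,
    union_sdiff_cancel hUsub, ⟨s, ?_⟩, ⟨t, ?_, ?_⟩⟩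
  · obtain ⟨O, C, -, hsO, hOC, hC⟩ := exists_gapArc hnc hD hy hK hrS (hSy s hsS) hrs.symm
    exact ⟨C, hC, hOC hsO, hOC hsO⟩
  · simp [hSy t htS, hrt.symm]
  · rintro ⟨C, hC, hs, ht⟩
    exact hC.right_notMem hnc hD hy hAS hP hyP hr hrs hrt hs ht

lemma isClosed_gapHull : IsClosed (gapHull S y) := by
  have : gapHull S y = ⋂ P ∈ {P | ∃ A s t, A ⊆ S ∧ Piece A s t P ∧ y ∈ P}, P := by
    ext z
    simp only [gapHull, mem_ofPred_eq, mem_iInter]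
    constructor
    · rintro h P ⟨A, s, t, hA, hP, hyP⟩
      exact h A s t P hA hP hyP
    · exact fun h A s t P hA hP hyP => h P ⟨A, s, t, hA, hP, hyP⟩
  rw [this]
  refine isClosed_biInter ?_
  rintro P ⟨A, s, t, -, hP, -⟩
  exact hP.isCompact.isClosed

lemma setOf_sEquiv (hy : y ∉ S) : {z | SEquiv S y z} = gapHull S y \ S := by
  ext z
  exact sEquiv_iff hy

lemma finite_gapHull_inter (hnc : ∀ p : X, ¬CutPoint p)
    (hD : ∀ A ⊆ S, A.Finite → ∃ B, A ⊆ B ∧ B ⊆ S ∧ DecSet B) (hy : y ∉ S) :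
    (gapHull S y ∩ S).Finite := by
  by_contra hinf
  obtain ⟨T, hT, hcard⟩ := Set.Infinite.exists_subset_card_eq hinf 3
  obtain ⟨B, s, t, P, hTB, hBS, hP, hyP, -⟩ := exists_piece_subset hnc hD hy
    (fun z hz => (hT hz).2) T.finite_toSet
  have hsub : (T : Set X) ⊆ {s, t} := fun z hz =>
    hP.eq_or_eq (hTB hz) ((hT hz).1 B s t P hBS hP hyP)
  have h1 := ncard_le_ncard hsub
  have h2 := ncard_insert_le s {t}
  rw [ncard_singleton] at h2
  rw [ncard_coe_finset, hcard] at h1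
  omega

lemma Piece.exists_notMem {A P : Set X} {s t : X} (h : Piece A s t P) : ∃ r ∈ A, r ∉ P := by
  obtain ⟨r, hr, hrs, hrt⟩ := h.exists_third
  exact ⟨r, hr, fun hrP => (h.eq_or_eq hr hrP).elim hrs hrt⟩

lemma Piece.end_mem_closure_compl (hnc : ∀ p : X, ¬CutPoint p) {A P : Set X} {s t : X}
    (h : Piece A s t P) : s ∈ closure Pᶜ ∧ t ∈ closure Pᶜ := by
  have key : ∀ a b, a ∈ P → b ∈ P → a ≠ b → IsOpen (P \ {a, b}) → a ∈ closure Pᶜ := by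
    intro a b ha hb hab hO
    by_contra hcl
    rw [closure_compl, mem_compl_iff, not_not] at hcl
    obtain ⟨r, -, hr⟩ := h.exists_notMem
    refine not_cutPoint_partition (hnc b) (U := P \ {a, b} ∪ interior P ∩ {b}ᶜ) (V := Pᶜ)
      (hO.union (isOpen_interior.inter isOpen_compl_singleton))
      h.isCompact.isClosed.isOpen_compl ?_ (fun h => h hb) ?_ ?_ ⟨a, Or.inr ⟨hcl, hab⟩⟩ ⟨r, hr⟩
    · rintro (h | h)
      exacts [h.2 (by simp), h.2 rfl]
    · rintro z (hz | hz) hz'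
      exacts [hz' hz.1, hz' (interior_subset hz.1)]
    · intro z hz
      by_cases hzP : z ∈ P
      · by_cases hza : z = a
        · subst hza
          exact Or.inl (Or.inr ⟨hcl, hz⟩)
        · exact Or.inl (Or.inl ⟨hzP, by simp [hza, hz]⟩)
      · exact Or.inr hzP
  exact ⟨key s t h.left_mem.2 h.right_mem.2 h.ne h.isOpen_diff,
    key t s h.right_mem.2 h.left_mem.2 h.ne.symm (pair_comm s t ▸ h.isOpen_diff)⟩

lemma closure_subset_gapHull : closure (gapHull S y \ S) ⊆ gapHull S y :=
  closure_minimal sdiff_subset isClosed_gapHull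

lemma frontier_subset_closure_compl_gapHull (hnc : ∀ p : X, ¬CutPoint p)
    (hD : ∀ A ⊆ S, A.Finite → ∃ B, A ⊆ B ∧ B ⊆ S ∧ DecSet B) (hy : y ∉ S) :
    frontier (gapHull S y \ S) ⊆ closure (gapHull S y)ᶜ := by
  intro a ha
  rw [frontier_eq_closure_inter_closure] at ha
  have e : (gapHull S y \ S)ᶜ = (gapHull S y)ᶜ ∪ gapHull S y ∩ S := by
    ext z
    simp only [mem_compl_iff, mem_sdiff, mem_union, mem_inter_iff]
    tauto
  have ha2 := ha.2
  rw [e, closure_union, (finite_gapHull_inter hnc hD hy).isClosed.closure_eq] at ha2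
  refine ha2.elim id fun h => ?_
  obtain ⟨B, s, t, P, haB, hBS, hP, hyP, -⟩ := exists_piece_subset hnc hD hy
    (singleton_subset_iff.2 h.2) (finite_singleton a)
  have hsub : Pᶜ ⊆ (gapHull S y)ᶜ := fun z hz hz' => hz (hz' B s t P hBS hP hyP)
  refine closure_mono hsub ?_
  have := hP.end_mem_closure_compl hnc
  rcases hP.eq_or_eq (haB rfl) (h.1 B s t P hBS hP hyP) with e | e
  exacts [e ▸ this.1, e ▸ this.2]

/-- The hull of a class consisting of a single point does not meet `S`. -/
lemma gapHull_inter_eq_empty (hnc : ∀ p : X, ¬CutPoint p)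
    (hD : ∀ A ⊆ S, A.Finite → ∃ B, A ⊆ B ∧ B ⊆ S ∧ DecSet B) (hy : y ∉ S)
    (hQ : gapHull S y \ S ⊆ {y}) : gapHull S y ∩ S = ∅ := by
  obtain ⟨O₁, O₂, hO₁, hO₂, hyO, hKO, hdis⟩ := SeparatedNhds.of_isCompact_isCompact
    (isCompact_singleton (x := y)) (finite_gapHull_inter hnc hD hy).isCompact
    (disjoint_singleton_left.2 fun h => hy h.2)
  let ι := {P : Set X // ∃ A s t, A ⊆ S ∧ Piece A s t P ∧ y ∈ P}
  have hne : Nonempty ι := by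
    obtain ⟨B, s, t, P, -, hBS, hP, hyP, -⟩ :=
      exists_piece_subset hnc hD hy (empty_subset S) finite_empty
    exact ⟨⟨P, B, s, t, hBS, hP, hyP⟩⟩
  have hdir : Directed (· ⊇ ·) (fun P : ι => (P : Set X)) := by
    rintro ⟨P, A, s, t, hA, hP, hyP⟩ ⟨P', A', s', t', hA', hP', hyP'⟩
    obtain ⟨B, u, v, Q, -, hBS, hQ, hyQ, hmin⟩ := exists_piece_subset hnc hD hy
      (union_subset hA hA') (hP.decSet.finite.union hP'.decSet.finite)
    exact ⟨⟨Q, B, u, v, hBS, hQ, hyQ⟩, hmin A s t P subset_union_left hP hyP,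
      hmin A' s' t' P' subset_union_right hP' hyP'⟩
  obtain ⟨⟨P, A, s, t, hA, hP, hyP⟩, hPO⟩ := exists_subset_nhds_of_isCompact' hdir
    (fun ⟨P, A, s, t, hA, hP, hyP⟩ => hP.isCompact)
    (fun ⟨P, A, s, t, hA, hP, hyP⟩ => hP.isCompact.isClosed) (U := O₁ ∪ O₂) (by
      intro z hz
      have hzK : z ∈ gapHull S y := fun A s t P hA hP hyP =>
        mem_iInter.1 hz ⟨P, A, s, t, hA, hP, hyP⟩
      refine (hO₁.union hO₂).mem_nhds ?_
      by_cases hzS : z ∈ S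
      · exact Or.inr (hKO ⟨hzK, hzS⟩)
      · exact Or.inl (hyO (hQ ⟨hzK, hzS⟩)))
  rw [eq_empty_iff_forall_notMem]
  intro z hz
  obtain ⟨w, -, hw1, hw2⟩ := hP.isPreconnected O₁ O₂ hO₁ hO₂ hPO ⟨y, hyP, hyO rfl⟩
    ⟨z, hz.1 A s t P hA hP hyP, hKO hz⟩
  exact Set.disjoint_left.1 hdis hw1 hw2

lemma frontier_nontrivial (hnc : ∀ p : X, ¬CutPoint p)
    (hD : ∀ A ⊆ S, A.Finite → ∃ B, A ⊆ B ∧ B ⊆ S ∧ DecSet B)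
    (hC : ∀ c, CyclicSet (insert c S) → c ∈ S) (hy : y ∉ S) : (frontier (gapHull S y \ S)).Nontrivial := by
  by_contra hnt
  obtain ⟨p, hp⟩ : ∃ p, frontier (gapHull S y \ S) ⊆ {p} := by
    rcases (Set.not_nontrivial_iff.1 hnt).eq_empty_or_singleton with h | ⟨p, h⟩
    exacts [⟨y, by simp [h]⟩, ⟨p, h.le⟩]
  have hcov : ∀ z, z ≠ p → z ∈ closure (gapHull S y \ S) → z ∈ interior (gapHull S y \ S) :=
    fun z hz h => by
      by_contra h'
      exact hz (hp ⟨h, h'⟩)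
  by_cases hV : ((closure (gapHull S y \ S))ᶜ ∩ {p}ᶜ).Nonempty
  · have hU : ¬(interior (gapHull S y \ S) ∩ {p}ᶜ).Nonempty := fun hU =>
      not_cutPoint_partition (hnc p) (isOpen_interior.inter isOpen_compl_singleton)
        (isClosed_closure.isOpen_compl.inter isOpen_compl_singleton) (fun h => h.2 rfl)
        (fun h => h.2 rfl) (fun z hz hz' => hz'.1 (subset_closure (interior_subset hz.1)))
        (fun z hz => by
          by_cases h : z ∈ closure (gapHull S y \ S)
          exacts [Or.inl ⟨hcov z hz h, hz⟩, Or.inr ⟨h, hz⟩]) hU hV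
    have hQp : gapHull S y \ S ⊆ {p} := fun z hz => by
      by_contra hzp
      exact hU ⟨z, hcov z hzp (subset_closure hz), hzp⟩
    have hyp : y = p := hQp ⟨mem_gapHull, hy⟩
    subst hyp
    have hem := gapHull_inter_eq_empty hnc hD hy hQp
    have hK : ∀ z ≠ y, z ∉ gapHull S y := by
      intro z hz hzK
      by_cases hzS : z ∈ S
      · exact eq_empty_iff_forall_notMem.1 hem z ⟨hzK, hzS⟩
      · exact hz (hQp ⟨hzK, hzS⟩)
    obtain ⟨r, hr, hcut⟩ := exists_cuts_of_gapHull hnc hD hy hK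
    exact hy (hC y (cyclicSet_insert hnc hD hy mem_gapHull hy hr hcut))
  · obtain ⟨B, s, t, P, -, hBS, hP, hyP, -⟩ :=
      exists_piece_subset hnc hD hy (empty_subset S) finite_empty
    have hsub : Pᶜ ⊆ {p} := fun z hz => by
      by_contra hzp
      exact hV ⟨z, fun h => hz (closure_subset_gapHull h B s t P hBS hP hyP), hzp⟩
    obtain ⟨r, -, hr⟩ := hP.exists_notMem
    have hs : s ∈ ({p} : Set X) := closure_minimal hsub isClosed_singleton
      (hP.end_mem_closure_compl hnc).1
    have hrp : r = p := hsub hr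
    exact hr (hrp.trans (mem_singleton_iff.1 hs).symm ▸ hP.left_mem.2)

lemma not_separates_frontier (hnc : ∀ p : X, ¬CutPoint p)
    (hD : ∀ A ⊆ S, A.Finite → ∃ B, A ⊆ B ∧ B ⊆ S ∧ DecSet B)
    (hC : ∀ c, CyclicSet (insert c S) → c ∈ S) (hy : y ∉ S) {a b c d : X} (ha : a ∈ frontier (gapHull S y \ S))
    (hb : b ∈ frontier (gapHull S y \ S)) : ¬Separates ({c, d} : Set X) {a} {b} := by
  rintro ⟨U, V, hUV, haU, hbV⟩
  rw [singleton_subset_iff] at haU hbV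
  have hcut : Cuts ({c, d} : Set X) := ⟨U, V, hUV⟩
  obtain ⟨hU, hV⟩ := hUV.isOpen (toFinite _).isClosed
  obtain ⟨-, -, hdis, hun, -, -⟩ := hUV
  have hno : ∀ C : Set X, IsPreconnected C → c ∉ C → d ∉ C → (C ∩ U).Nonempty →
      ¬(C ∩ V).Nonempty := by
    intro C hCp hc hd hCU hCV
    obtain ⟨z, -, h1, h2⟩ := hCp U V hU hV (fun z hz => by
      rw [hun]
      rintro (rfl | rfl)
      exacts [hc hz, hd hz]) hCU hCV
    exact Set.disjoint_left.1 hdis h1 h2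
  have hcd : c ∉ U ∧ c ∉ V ∧ d ∉ U ∧ d ∉ V := by
    have h : ∀ z, z ∈ U ∪ V ↔ z ∈ ({c, d} : Set X)ᶜ := fun z => by rw [hun]
    have h1 := h c
    have h2 := h d
    simp only [mem_union, mem_compl_iff, mem_insert_iff, mem_singleton_iff] at h1 h2
    tauto
  have haK := closure_subset_gapHull ha.1
  have hbK := closure_subset_gapHull hb.1
  have hmixed : ∀ c' d', ({c', d'} : Set X) = {c, d} → c' ∈ gapHull S y →
      d' ∉ gapHull S y → False := by
    intro c' d' he hc hd
    have hc'S : c' ∈ S := by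
      by_contra h
      exact h (hC c' (cyclicSet_insert hnc hD hy hc h hd (he ▸ hcut)))
    obtain ⟨B, s, t, P, hcB, hBS, hP, hyP, hdP, -⟩ := exists_piece_avoiding hnc hD hy
      (singleton_subset_iff.2 hc'S) (finite_singleton c') hd hd
    have hpre : IsPreconnected (P \ {c'}) := by
      rcases hP.eq_or_eq (hcB rfl) (hc B s t P hBS hP hyP) with e | e
      exacts [e ▸ hP.isPreconnected_diff_left hnc, e ▸ hP.isPreconnected_diff_right hnc]
    have hout : ∀ z ∈ ({c, d} : Set X), z ∉ P \ {c'} := by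
      rw [← he]
      rintro z (rfl | rfl) hz
      exacts [hz.2 rfl, hdP hz.1]
    have hc' : c' ∉ U ∧ c' ∉ V := by
      have : c' ∈ ({c, d} : Set X) := he ▸ mem_insert _ _
      rcases this with rfl | rfl
      exacts [⟨hcd.1, hcd.2.1⟩, hcd.2.2]
    refine hno _ hpre (hout c (by simp)) (hout d (by simp))
      ⟨a, ⟨haK B s t P hBS hP hyP, ?_⟩, haU⟩ ⟨b, ⟨hbK B s t P hBS hP hyP, ?_⟩, hbV⟩
    · rintro rfl
      exact hc'.1 haU
    · rintro rfl
      exact hc'.2 hbV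
  by_cases hc : c ∈ gapHull S y <;> by_cases hd : d ∈ gapHull S y
  · have hfr := frontier_subset_closure_compl_gapHull hnc hD hy
    obtain ⟨l, hlU, hl⟩ := mem_closure_iff.1 (hfr ha) U hU haU
    obtain ⟨m, hmV, hm⟩ := mem_closure_iff.1 (hfr hb) V hV hbV
    obtain ⟨B, s, t, P, -, hBS, hP, hyP, hlP, hmP, -⟩ := exists_piece_avoiding hnc hD hy
      (empty_subset S) finite_empty hl hm
    exact hno _ (hP.isPreconnected_compl hnc) (fun h => h (hc B s t P hBS hP hyP))
      (fun h => h (hd B s t P hBS hP hyP)) ⟨l, hlP, hlU⟩ ⟨m, hmP, hmV⟩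
  · exact hmixed c d rfl hc hd
  · exact hmixed d c (pair_comm d c) hd hc
  · obtain ⟨B, s, t, P, -, hBS, hP, hyP, hcP, hdP, -⟩ := exists_piece_avoiding hnc hD hy
      (empty_subset S) finite_empty hc hd
    exact hno _ hP.isPreconnected hcP hdP ⟨a, haK B s t P hBS hP hyP, haU⟩
      ⟨b, hbK B s t P hBS hP hyP, hbV⟩

end Gap

lemma Necklace.exists_decSet {S : Set X} (hS : Necklace S) :
    ∀ A ⊆ S, A.Finite → ∃ B, A ⊆ B ∧ B ⊆ S ∧ DecSet B := by
  classical
  intro A hA hf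
  obtain ⟨hC, ⟨a, ha, b, hb, c, hc, hab, hac, hbc⟩, -⟩ := hS
  have hT : ({a, b, c} : Finset X).card = 3 := Finset.card_eq_three.2 ⟨a, b, c, hab, hac, hbc, rfl⟩
  have hcard : 3 ≤ (hf.toFinset ∪ {a, b, c}).card :=
    hT ▸ Finset.card_le_card Finset.subset_union_right
  have hsub : (↑(hf.toFinset ∪ {a, b, c}) : Set X) ⊆ S := by
    simp [insert_subset_iff, hA, ha, hb, hc]
  refine ⟨↑(hf.toFinset ∪ {a, b, c}), fun z hz => by simp [hz], hsub, ?_⟩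
  exact (hC _ hsub (by omega)).decSet (by rwa [ncard_coe_finset])

lemma Necklace.mem_of_cyclicSet_insert {S : Set X} (hS : Necklace S) (c : X)
    (hc : CyclicSet (insert c S)) : c ∈ S :=
  hS.2.2 _ hc (subset_insert c S) ▸ mem_insert c S

end Helpers

/-- the union of the sides of a gap of a necklace `S`
(= the frontier of the corresponding `S`-equivalence class) is a nonsingleton
inseparable set. -/
theorem stmt10 {X : Type*} [MetricSpace X] [CompactSpace X] [ConnectedSpace X]
    (hnc : ∀ p : X, ¬CutPoint p)
    (S : Set X) (hS : Necklace S) (y : X) (hy : y ∉ S) :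
    InsepSet (frontier {z : X | SEquiv S y z}) := by
  rw [setOf_sEquiv hy]
  exact ⟨frontier_nontrivial hnc hS.exists_decSet hS.mem_of_cyclicSet_insert hy,
    fun c d _ a ha b hb => not_separates_frontier hnc hS.exists_decSet
      hS.mem_of_cyclicSet_insert hy ha hb⟩
end
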